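/- (Conjecture of Berkovich and Yesilyurt, proved in the paper.) For every natural number n, the number of triples (x,y,z) ∈ ℤ³ with n = x(x+1)/2 + y² + z² is greater than or equal to the number of triples (x,y,z) ∈ ℤ³ with n = x(x+1)/2 + 7y² + 7z². -/

import Mathlib

def TRep (a b c d e f : ℤ) : Prop :=
  ∃ p1 p2 p3 q1 q2 q3 r1 r2 r3 : ℤ,
    a = p1^2+p2^2+p3^2 ∧ b = q1^2+q2^2+q3^2 ∧ c = r1^2+r2^2+r3^2 ∧
    d = q1*r1+q2*r2+q3*r3 ∧ e = p1*r1+p2*r2+p3*r3 ∧ f = p1*q1+p2*q2+p3*q3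

lemma exists_shift (f a : ℤ) (ha : 0 < a) : ∃ t : ℤ, |2 * (f + t * a)| ≤ a := by
  refine ⟨-((2*f+a)/(2*a)), ?_⟩
  have h1 := Int.emod_add_mul_ediv (2*f+a) (2*a)
  have h2 := Int.emod_nonneg (2*f+a) (by omega : 2*a ≠ 0)
  have h3 := Int.emod_lt_of_pos (2*f+a) (by omega : 0 < 2*a)
  rw [abs_le]
  constructor <;> nlinarith

lemma binary_rep (n : ℕ) : ∀ a f c : ℤ, a.toNat ≤ n → 0 < a → a * c - f^2 = 1 →
    ∃ p q r s : ℤ, a = p^2 + r^2 ∧ f = p*q + r*s ∧ c = q^2+s^2 := by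
  induction n with
  | zero => intro a f c h1 h2; omega
  | succ n ih =>
    intro a f c hn ha hd
    obtain ⟨t, ht⟩ := exists_shift f a ha
    set f' := f + t * a with hf'
    set c' := c + 2*t*f + t^2*a with hc'
    have hd' : a * c' - f'^2 = 1 := by rw [hf', hc']; linear_combination hd
    have hc0 : 0 < c' := by
      by_contra h
      push Not at h
      nlinarith [sq_nonneg f', mul_nonneg ha.le (neg_nonneg.2 h)]
    have key : ∃ p q r s : ℤ, a = p^2 + r^2 ∧ f' = p*q + r*s ∧ c' = q^2+s^2 := by
      rcases lt_or_ge c' a with h | h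
      · obtain ⟨p, q, r, s, h1, h2, h3⟩ := ih c' f' a (by omega) hc0 (by linarith)
        exact ⟨q, p, s, r, h3, by rw [h2]; ring, h1⟩
      · have : a = 1 := by
          have h4 : 4 * f'^2 ≤ a^2 := by
            have := sq_le_sq' (by linarith [abs_nonneg (2*f')] : -a ≤ |2*f'|) ht
            rw [sq_abs] at this; linarith
          nlinarith
        refine ⟨1, f', 0, 1, by rw [this]; norm_num, by ring, ?_⟩
        rw [this] at hd'; linarith
    obtain ⟨p, q, r, s, h1, h2, h3⟩ := key
    refine ⟨p, q - t*p, r, s - t*r, h1, ?_, ?_⟩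
    · linear_combination h2 - t * h1
    · linear_combination h3 - 2*t*h2 + t^2*h1

lemma aux_bound (a C K h : ℤ) (hC : 0 < C) (hKC : C ≤ K) (hdet : C*K - h^2 = a)
    (h5 : 4*h^2 ≤ C^2) : 3*C^2 ≤ 4*a := by
  have := mul_le_mul_of_nonneg_left hKC hC.le
  linarith [sq C]

lemma aux_one (a C : ℤ) (ha : 0 < a) (h1 : 3*a^2 ≤ 4*C) (h2 : 3*C^2 ≤ 4*a) : a = 1 := by
  by_contra hne
  have ha2 : 2 ≤ a := by omega
  have : a ≤ C := by nlinarith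
  nlinarith

lemma ternary_rep (n : ℕ) : ∀ a b c d e f : ℤ, (a + (a*b-f^2)).toNat ≤ n → 0 < a → 0 < a*b-f^2 →
    a*b*c + 2*d*e*f - a*d^2 - b*e^2 - c*f^2 = 1 → TRep a b c d e f := by
  induction n with
  | zero => intro a b c d e f h1 h2; omega
  | succ n ih =>
    intro a b c d e f hn ha hC hD
    -- shift q by p
    obtain ⟨t, ht⟩ := exists_shift f a ha
    set f' := f + t * a with hf'
    set b' := b + 2*t*f + t^2*a with hb'
    set d' := d + t * e with hd'
    have hC' : a*b'-f'^2 = a*b-f^2 := by rw [hf', hb']; ring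
    have hD' : a*b'*c + 2*d'*e*f' - a*d'^2 - b'*e^2 - c*f'^2 = 1 := by
      rw [hf', hb', hd']; linear_combination hD
    have h4 : 4 * f'^2 ≤ a^2 := by
      have := sq_le_sq' (by linarith [abs_nonneg (2*f')] : -a ≤ |2*f'|) ht
      rw [sq_abs] at this; linarith
    have hb0 : 0 < b' := by
      by_contra h
      push Not at h
      nlinarith [sq_nonneg f', mul_nonneg ha.le (neg_nonneg.2 h)]
    suffices key : TRep a b' c d' e f' by
      obtain ⟨p1, p2, p3, q1, q2, q3, r1, r2, r3, h1, h2, h3, h4, h5, h6⟩ := key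
      refine ⟨p1, p2, p3, q1 - t*p1, q2-t*p2, q3-t*p3, r1, r2, r3, h1, ?_, h3, ?_, h5, ?_⟩
      · linear_combination h2 - 2*t*h6 + t^2*h1
      · linear_combination h4 - t*h5
      · linear_combination h6 - t*h1
    rcases lt_or_ge b' a with hba | hba
    · have := ih b' a c e d' f' (by rw [mul_comm b' a]; omega) hb0 (by linarith) (by linarith)
      obtain ⟨p1, p2, p3, q1, q2, q3, r1, r2, r3, h1, h2, h3, h4, h5, h6⟩ := this
      exact ⟨q1, q2, q3, p1, p2, p3, r1, r2, r3, h2, h1, h3, h5, h4, by rw [h6]; ring⟩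
    have hr1 : 3*a^2 ≤ 4*(a*b'-f'^2) := aux_bound _ a b' f' ha hba rfl h4
    set C := a*b'-f'^2 with hCdef
    have hC0 : 0 < C := by linarith
    obtain ⟨s, hs⟩ := exists_shift (a*d'-e*f') C hC0
    -- shift r by s q
    set c2 := c + 2*s*d' + s^2*b' with hc2
    set d2 := d' + s*b' with hd2
    set e2 := e + s*f' with he2
    have hH : a*d2 - e2*f' = a*d'-e*f' + s*C := by rw [hd2, he2, hCdef]; ring
    have hD2 : a*b'*c2 + 2*d2*e2*f' - a*d2^2 - b'*e2^2 - c2*f'^2 = 1 := by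
      rw [hc2, hd2, he2]; linear_combination hD'
    suffices key : TRep a b' c2 d2 e2 f' by
      obtain ⟨p1, p2, p3, q1, q2, q3, r1, r2, r3, h1, h2, h3, h4, h5, h6⟩ := key
      refine ⟨p1, p2, p3, q1, q2, q3, r1-s*q1, r2-s*q2, r3-s*q3, h1, h2, ?_, ?_, ?_, h6⟩
      · linear_combination h3 - 2*s*h4 + s^2*h2
      · linear_combination h4 - s*h2
      · linear_combination h5 - s*h6
    rw [← hH] at hs
    set Hh := a*d2-e2*f' with hHh
    set K := a*c2-e2^2 with hK
    have hdet : C*K - Hh^2 = a := by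
      rw [hCdef, hHh, hK]; linear_combination a*hD2
    have hK0 : 0 < K := by
      by_contra h
      push Not at h
      nlinarith [sq_nonneg Hh, mul_nonneg hC0.le (neg_nonneg.2 h)]
    have h5 : 4 * Hh^2 ≤ C^2 := by
      have := sq_le_sq' (by linarith [abs_nonneg (2*Hh)] : -C ≤ |2*Hh|) hs
      rw [sq_abs] at this; linarith
    rcases lt_or_ge K C with hKC | hKC
    · have := ih a c2 b' d2 f' e2 (by omega) ha (by linarith) (by linarith)
      obtain ⟨p1, p2, p3, q1, q2, q3, r1, r2, r3, h1, h2, h3, h4, h5, h6⟩ := this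
      exact ⟨p1, p2, p3, r1, r2, r3, q1, q2, q3, h1, h3, h2, by rw [h4]; ring, h6, h5⟩
    have hr2 : 3*C^2 ≤ 4*a := aux_bound a C K Hh hC0 hKC hdet h5
    have ha1 : a = 1 := aux_one a C ha hr1 hr2
    -- finish
    clear_value f' b' d' c2 d2 e2
    obtain ⟨p, q, r, u, g1, g2, g3⟩ := binary_rep C.toNat C Hh K le_rfl hC0 (by rw [hdet, ha1])
    refine ⟨1, 0, 0, f', p, r, e2, q, u, by rw [ha1]; norm_num, ?_, ?_, ?_, by ring, by ring⟩
    · linear_combination g1 - hCdef - b'*ha1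
    · linear_combination g3 - hK - c2*ha1
    · linear_combination g2 - hHh - d2*ha1

lemma three_squares (m : ℕ) (hm : m % 8 = 1) : ∃ x y z u v w : ℤ, x^2+y^2+z^2 = m ∧ 
    u*x+v*y+w*z = 1 := by
  have hm0 : m ≠ 0 := by omega
  -- prime q ≡ 1 mod 4, ≡ -1 mod m
  obtain ⟨q, hqgt, hq, hqm⟩ := Nat.forall_exists_prime_gt_and_zmodEq 2 (q := 4*m) (a := 2*m - 1)
    (by omega) (by
      push_cast
      have : ∃ k : ℤ, (m:ℤ) = 8*k+1 := ⟨m/8, by omega⟩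
      obtain ⟨k, hk⟩ := this
      refine ⟨-(2*m+1), m, ?_⟩
      ring)
  have : Fact q.Prime := ⟨hq⟩
  have hdv : ((4*m : ℕ):ℤ) ∣ (2*m-1) - q := by exact_mod_cast hqm.dvd
  obtain ⟨k, hk⟩ := hdv
  push_cast at hk
  have hq4 : q % 4 = 1 := by
    have : (q:ℤ) % 4 = 1 := by
      have : (q:ℤ) = 2*m - 1 - 4*(m*k) := by linarith
      omega
    omega
  have hJ : jacobiSym (-m) q = 1 := by
    rw [jacobiSym.neg _ (by rw [Nat.odd_iff]; omega), ZMod.χ₄_nat_one_mod_four hq4, one_mul,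
      jacobiSym.quadratic_reciprocity_one_mod_four' (by rw [Nat.odd_iff]; omega) hq4]
    have : jacobiSym q m = jacobiSym (-1) m := by
      apply jacobiSym.mod_left'
      apply Int.ModEq.eq
      apply (Int.modEq_iff_dvd).2
      exact ⟨-2+4*k, by linarith⟩
    rw [this, jacobiSym.at_neg_one (by rw [Nat.odd_iff]; omega), ZMod.χ₄_nat_one_mod_four (by omega)]
  have hsq := ZMod.isSquare_of_jacobiSym_eq_one hJ
  obtain ⟨y, hy⟩ := hsq
  obtain ⟨y, rfl⟩ := ZMod.intCast_surjective y
  have hdvd : (q:ℤ) ∣ y^2 + m := by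
    rw [← ZMod.intCast_zmod_eq_zero_iff_dvd]
    push_cast at hy ⊢
    rw [sq, ← hy]; ring
  -- b*m = q+1
  set b : ℤ := 2 - 4*k with hb
  have hbm : b*m = q+1 := by rw [hb]; linarith
  -- a12 = b*y
  have h2 : (q:ℤ) ∣ b + (b*y)^2 := by
    have h3 : b + (b*y)^2 = b^2*(y^2+m) - b*(b*m-1) := by ring
    rw [h3, hbm]
    exact dvd_sub (hdvd.mul_left _) ⟨b, by ring⟩
  obtain ⟨a, ha⟩ := h2
  have hmpos : (0:ℤ) < m := by omega
  have hqpos : (0:ℤ) < q := by omega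
  have hbpos : 0 < b := by
    by_contra h
    push Not at h
    nlinarith
  have hapos : 0 < a := by
    by_contra h
    push Not at h
    nlinarith [sq_nonneg (b*y)]
  have := ternary_rep _ a q m 0 1 (b*y) le_rfl hapos (by linarith) (by
    linear_combination (-(m:ℤ))*ha + hbm)
  obtain ⟨p1, p2, p3, q1, q2, q3, r1, r2, r3, h1, h2, h3, h4, h5, h6⟩ := this
  exact ⟨r1, r2, r3, p1, p2, p3, h3.symm, h5.symm⟩

abbrev Hd (d : ℤ) := QuaternionAlgebra ℤ (-1) 0 (-d)

def nm {d : ℤ} (x : Hd d) : ℤ := x.re^2 + x.imI^2 + d*x.imJ^2 + d*x.imK^2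

lemma nm_mul {d : ℤ} (x y : Hd d) : nm (x*y) = nm x * nm y := by
  simp only [nm, QuaternionAlgebra.re_mul, QuaternionAlgebra.imI_mul, QuaternionAlgebra.imJ_mul,
    QuaternionAlgebra.imK_mul]
  ring

lemma nm_star {d : ℤ} (x : Hd d) : nm (star x) = nm x := by
  simp [nm]

lemma nm_int {d : ℤ} (n : ℤ) : nm (n : Hd d) = n^2 := by
  simp [nm]

lemma star_mul_nm {d : ℤ} (x : Hd d) : star x * x = ((nm x : ℤ) : Hd d) := by
  ext <;> simp <;> (try simp only [nm]) <;> ring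

lemma mul_star_nm {d : ℤ} (x : Hd d) : x * star x = ((nm x : ℤ) : Hd d) := by
  ext <;> simp <;> (try simp only [nm]) <;> ring

lemma xyx {d : ℤ} (x y : Hd d) (t : ℤ) (ht : t = 2*(x*y).re) :
    x * y * x = (t : Hd d) * x - ((nm x : ℤ) : Hd d) * star y := by
  simp at ht
  ext <;> simp <;> simp only [nm, ht] <;> ring

lemma int_cancel {d : ℤ} {n : ℤ} (hn : n ≠ 0) {x y : Hd d} (h : (n : Hd d) * x = n * y) : x = y := by
  have h1 := congrArg QuaternionAlgebra.re h
  have h2 := congrArg QuaternionAlgebra.imI h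
  have h3 := congrArg QuaternionAlgebra.imJ h
  have h4 := congrArg QuaternionAlgebra.imK h
  simp at h1 h2 h3 h4
  ext <;> tauto

lemma icomm {d : ℤ} (n : ℤ) (x : Hd d) : x * (n : Hd d) = n * x := ((Int.cast_commute n x).eq).symm

lemma right_cancel' {d : ℤ} {z : Hd d} (hz : nm z ≠ 0) {x y : Hd d} (h : x * z = y * z) : x = y := by
  apply int_cancel hz
  have := congrArg (· * star z) h
  simp only [mul_assoc, mul_star_nm] at this
  rwa [icomm, icomm] at this

/-- pure elements -/
lemma pure_star {d : ℤ} {v : Hd d} (h : v.re = 0) : star v = -v := by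
  ext <;> simp [h]

lemma pure_sq {d : ℤ} {v : Hd d} (h : v.re = 0) : v * v = ((-(nm v) : ℤ) : Hd d) := by
  have := star_mul_nm v
  rw [pure_star h] at this
  push_cast
  rw [← this]; simp

lemma ev_mul {d m : ℤ} {v : Hd d} (h : v.re = 0) (hm : nm v = m) (f g x y : ℤ) :
    ((f : Hd d) + g * v) * (x + y * v) = ((f*x - m*g*y : ℤ) : Hd d) + ((f*y+g*x : ℤ) : Hd d) * v := by
  have h1 : v.imI^2 + d*v.imJ^2 + d*v.imK^2 = m := by rw [← hm, nm, h]; ring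
  generalize hP : f*x - m*g*y = P
  generalize hQ : f*y+g*x = Q
  ext
  · simp [h]; rw [← hP, ← h1]; ring
  all_goals simp [h]; rw [← hQ]; ring

lemma nm_nonneg {x : Hd 1} : 0 ≤ nm x := by unfold nm; positivity

lemma nm_sub_mul (a δ b : Hd 1) : nm b * nm (a - δ * b) = nm (a * star b - ((nm b : ℤ) : Hd 1) * δ) := by
  rw [← nm_star b, mul_comm, ← nm_mul, nm_star, sub_mul, mul_assoc, mul_star_nm, icomm]

lemma round_odd (y n : ℤ) (hn : 0 < n) (hodd : n % 2 = 1) : ∃ δ : ℤ, -n < 2*(y-n*δ) ∧ 2*(y-n*δ) < n := by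
  refine ⟨(2*y+n)/(2*n), ?_⟩
  have h1 := Int.emod_add_mul_ediv (2*y+n) (2*n)
  have h2 := Int.emod_nonneg (2*y+n) (by omega : 2*n ≠ 0)
  have h3 := Int.emod_lt_of_pos (2*y+n) (by omega : 0 < 2*n)
  have e : 2*n*((2*y+n)/(2*n)) = 2*(n*((2*y+n)/(2*n))) := by ring
  rw [e] at h1
  generalize n*((2*y+n)/(2*n)) = t at *
  omega

lemma sq_lt_of (n r : ℤ) (h1 : -n < 2*r) (h2 : 2*r < n) : 4*r^2 < n^2 := by nlinarith

/-- moving the largest coordinate -/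
lemma move_coord (n a b c d : ℤ) (hn : 0 < n) (h1 : -n < 2*a) (h2 : 2*a < n) (ha : a ≠ 0)
    (hb : b^2 ≤ a^2) (hc : c^2 ≤ a^2) (hd : d^2 ≤ a^2) :
    ∃ s : ℤ, (s = 1 ∨ s = -1) ∧ (a - n*s)^2+b^2+c^2+d^2 < n^2 := by
  rcases lt_or_gt_of_ne ha with h | h
  · exact ⟨-1, Or.inr rfl, by nlinarith⟩
  · exact ⟨1, Or.inl rfl, by nlinarith⟩

lemma round_quat (y : Hd 1) (n : ℤ) (hn : 0 < n) (hodd : n % 2 = 1) :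
    (∃ δ : Hd 1, y = n * δ) ∨
    ∃ δ : Hd 1, nm (y - (n : Hd 1) * δ) < n^2 ∧ nm (y - (n : Hd 1)*δ) % 2 = 1 := by
  obtain ⟨d1, a1, b1⟩ := round_odd y.re n hn hodd
  obtain ⟨d2, a2, b2⟩ := round_odd y.imI n hn hodd
  obtain ⟨d3, a3, b3⟩ := round_odd y.imJ n hn hodd
  obtain ⟨d4, a4, b4⟩ := round_odd y.imK n hn hodd
  have e : ∀ e1 e2 e3 e4 : ℤ, nm (y - (n : Hd 1) * (⟨d1+e1, d2+e2, d3+e3, d4+e4⟩ : Hd 1)) = 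
     ((y.re - n*d1) - n*e1)^2 + ((y.imI - n*d2) - n*e2)^2 + ((y.imJ - n*d3) - n*e3)^2 +
     ((y.imK - n*d4) - n*e4)^2 := by
    intro e1 e2 e3 e4
    simp only [nm]; simp; ring
  have hz : (y.re - n*d1 = 0 ∧ y.imI - n*d2 = 0 ∧ y.imJ - n*d3 = 0 ∧ y.imK - n*d4 = 0) → 
      ∃ δ : Hd 1, y = n * δ := by
    rintro ⟨h1, h2, h3, h4⟩
    refine ⟨⟨d1, d2, d3, d4⟩, ?_⟩
    ext <;> simp <;> linarith
  generalize y.re - n*d1 = r1 at *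
  generalize y.imI - n*d2 = r2 at *
  generalize y.imJ - n*d3 = r3 at *
  generalize y.imK - n*d4 = r4 at *
  by_cases hz' : r1 = 0 ∧ r2 = 0 ∧ r3 = 0 ∧ r4 = 0
  · left; exact hz hz'
  right
  have q1 := sq_lt_of n r1 a1 b1
  have q2 := sq_lt_of n r2 a2 b2
  have q3 := sq_lt_of n r3 a3 b3
  have q4 := sq_lt_of n r4 a4 b4
  by_cases hp : (r1^2+r2^2+r3^2+r4^2) % 2 = 1
  · refine ⟨⟨d1+0, d2+0, d3+0, d4+0⟩, ?_⟩
    rw [e]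
    simp only [mul_zero, sub_zero]
    exact ⟨by linarith, hp⟩
  have par : ∀ s : ℤ, (s = 1 ∨ s = -1) → ∀ a b c d : ℤ, (a^2+b^2+c^2+d^2) % 2 ≠ 1 → 
      ((a-n*s)^2+b^2+c^2+d^2) % 2 = 1 := by
    intro s hs a b c d h
    have : (a-n*s)^2+b^2+c^2+d^2 = (a^2+b^2+c^2+d^2) + 2*(-(a*n*s)) + n*n*(s*s) := by ring
    rw [this]
    have hs2 : s*s = 1 := by rcases hs with h | h <;> rw [h] <;> norm_num
    have hn2 : (n*n) % 2 = 1 := by rw [Int.mul_emod, hodd]; norm_num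
    rw [hs2]; omega
  have nz : ∀ a b c d : ℤ, b^2 ≤ a^2 → c^2 ≤ a^2 → d^2 ≤ a^2 → a = 0 → b = 0 ∧ c = 0 ∧ d = 0 := by
    intro a b c d hb hc hd ha
    subst ha
    refine ⟨?_, ?_, ?_⟩ <;> nlinarith
  have hmax : (r2^2 ≤ r1^2 ∧ r3^2 ≤ r1^2 ∧ r4^2 ≤ r1^2) ∨ (r1^2 ≤ r2^2 ∧ r3^2 ≤ r2^2 ∧ r4^2 ≤ r2^2) ∨
     (r1^2 ≤ r3^2 ∧ r2^2 ≤ r3^2 ∧ r4^2 ≤ r3^2) ∨ (r1^2 ≤ r4^2 ∧ r2^2 ≤ r4^2 ∧ r3^2 ≤ r4^2) := by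
    omega
  rcases hmax with ⟨h1,h2,h3⟩ | ⟨h1,h2,h3⟩ | ⟨h1,h2,h3⟩ | ⟨h1,h2,h3⟩
  · obtain ⟨s, hs, hlt⟩ := move_coord n r1 r2 r3 r4 hn a1 b1 (fun h => hz' ⟨h, nz _ _ _ _ h1 h2 h3 h⟩) h1 h2 h3
    refine ⟨⟨d1+s, d2+0, d3+0, d4+0⟩, ?_⟩
    rw [e]
    simp only [mul_zero, sub_zero]
    exact ⟨by linarith, par s hs r1 r2 r3 r4 hp⟩
  · obtain ⟨s, hs, hlt⟩ := move_coord n r2 r1 r3 r4 hn a2 b2 (fun h => hz' (by have := nz _ _ _ _ h1 h2 h3 h; tauto)) h1 h2 h3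
    refine ⟨⟨d1+0, d2+s, d3+0, d4+0⟩, ?_⟩
    rw [e]
    simp only [mul_zero, sub_zero]
    have := par s hs r2 r1 r3 r4 (by omega)
    exact ⟨by linarith, by omega⟩
  · obtain ⟨s, hs, hlt⟩ := move_coord n r3 r1 r2 r4 hn a3 b3 (fun h => hz' (by have := nz _ _ _ _ h1 h2 h3 h; tauto)) h1 h2 h3
    refine ⟨⟨d1+0, d2+0, d3+s, d4+0⟩, ?_⟩
    rw [e]
    simp only [mul_zero, sub_zero]
    have := par s hs r3 r1 r2 r4 (by omega)
    exact ⟨by linarith, by omega⟩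
  · obtain ⟨s, hs, hlt⟩ := move_coord n r4 r1 r2 r3 hn a4 b4 (fun h => hz' (by have := nz _ _ _ _ h1 h2 h3 h; tauto)) h1 h2 h3
    refine ⟨⟨d1+0, d2+0, d3+0, d4+s⟩, ?_⟩
    rw [e]
    simp only [mul_zero, sub_zero]
    have := par s hs r4 r1 r2 r3 (by omega)
    exact ⟨by linarith, by omega⟩

/-- left ideal generated by two elements, first of odd norm, is principal -/
lemma principal (g h : Hd 1) (hg : nm g % 2 = 1) :
    ∃ β x y s t : Hd 1, β = x * g + y * h ∧ g = s * β ∧ h = t * β ∧ nm β % 2 = 1 := by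
  classical
  have hex : ∃ n : ℕ, ∃ x y : Hd 1, (nm (x*g+y*h)).toNat = n ∧ nm (x*g+y*h) % 2 = 1 :=
    ⟨_, 1, 0, rfl, by simpa using hg⟩
  obtain ⟨x, y, hn, hodd⟩ := Nat.find_spec hex
  have hmin : ∀ x' y' : Hd 1, nm (x'*g+y'*h) % 2 = 1 → nm (x*g+y*h) ≤ nm (x'*g+y'*h) := by
    intro x' y' h'
    by_contra hlt
    push Not at hlt
    have := Nat.find_min hex (m := (nm (x'*g+y'*h)).toNat) (by
      have := nm_nonneg (x := x'*g+y'*h)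
      omega)
    exact this ⟨x', y', rfl, h'⟩
  clear hn
  set β := x*g+y*h with hβ
  have hpos : 0 < nm β := by
    have := nm_nonneg (x := β)
    omega
  have key : ∀ x' y' : Hd 1, ∃ s, x'*g+y'*h = s * β := by
    intro x' y'
    rcases round_quat ((x'*g+y'*h) * star β) (nm β) hpos hodd with ⟨δ, hδ⟩ | ⟨δ, h1, h2⟩
    · refine ⟨δ, ?_⟩
      have : nm (star β) ≠ 0 := by rw [nm_star]; exact hpos.ne'
      apply right_cancel' this
      rw [hδ, mul_assoc, mul_star_nm, icomm]
    · exfalso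
      rw [← nm_sub_mul] at h1 h2
      have e : x'*g+y'*h - δ*β = (x'-δ*x)*g+(y'-δ*y)*h := by rw [hβ]; noncomm_ring
      rw [e] at h1 h2
      have h3 : nm ((x'-δ*x)*g+(y'-δ*y)*h) % 2 = 1 := by
        rw [Int.mul_emod, hodd] at h2
        omega
      have h4 := hmin _ _ h3
      nlinarith
  obtain ⟨s, hs⟩ := key 1 0
  obtain ⟨t, ht⟩ := key 0 1
  exact ⟨β, x, y, s, t, hβ, by simpa using hs, by simpa using ht, hodd⟩

lemma lemmaB (v0 : Hd 1) (m N b c : ℤ) (hre : v0.re = 0) (hm : nm v0 = m) (hN : 0 < N) (hodd : N % 2 = 1)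
    (hc : N * c = b^2 + m) (hcop : IsCoprime N c) :
    ∃ β v s x y : Hd 1, nm β = N ∧ β * v0 = v * β ∧ v0 - (b:Hd 1) = s * β ∧ β = x * (N:Hd 1) + y * (v0 - (b:Hd 1)) := by
  obtain ⟨β, x, y, s, t, h1, h2, h3, h4⟩ := principal (N:Hd 1) (v0 - (b:Hd 1)) (by
    rw [nm_int, sq, Int.mul_emod, hodd]; norm_num)
  have hnb : nm (v0 - (b:Hd 1)) = N * c := by
    rw [hc, ← hm]; simp only [nm]; simp [hre]; ring
  have hNβ : nm β = N := by
    have d1 : nm β ∣ N := by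
      have e1 : nm β ∣ N * N := ⟨nm s, by rw [mul_comm (nm β), ← nm_mul, ← h2, nm_int]; ring⟩
      have e2 : nm β ∣ N * c := ⟨nm t, by rw [mul_comm (nm β), ← nm_mul, ← h3, hnb]⟩
      obtain ⟨p, q, hpq⟩ := hcop
      have : N = p * (N*N) + q*(N*c) := by linear_combination (-N) * hpq
      rw [this]
      exact dvd_add (e1.mul_left _) (e2.mul_left _)
    have d2 : N ∣ nm β := by
      have : β * star β = (N:Hd 1) * (((N * nm x : ℤ) : Hd 1) + (x * star (v0 - (b:Hd 1)) * star y + y * (v0 - (b:Hd 1)) * star x) + ((c * nm y : ℤ) : Hd 1)) := by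
        have ee : (v0 - (b:Hd 1)) * star (v0 - (b:Hd 1)) = ((N*c : ℤ) : Hd 1) := by rw [mul_star_nm, hnb]
        have : β * star β = x * ((N:Hd 1)*(N:Hd 1)) * star x + (x * (N:Hd 1)) * star (v0 - (b:Hd 1)) * star y 
            + y * (v0 - (b:Hd 1)) * ((N:Hd 1) * star x) + y * ((v0 - (b:Hd 1)) * star (v0 - (b:Hd 1))) * star y := by
          rw [h1, star_add, star_mul, star_mul]
          have : star (N:Hd 1) = (N:Hd 1) := by ext <;> simp
          rw [this]
          noncomm_ring
        rw [this, ee]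
        have f1 : x * ((N:Hd 1)*(N:Hd 1)) * star x = (N:Hd 1) * ((N * nm x : ℤ) : Hd 1) := by
          rw [← Int.cast_mul, icomm, mul_assoc, mul_star_nm]; push_cast; noncomm_ring
        have f2 : y * ((N*c : ℤ) : Hd 1) * star y = (N:Hd 1) * ((c * nm y : ℤ) : Hd 1) := by
          rw [icomm, mul_assoc, mul_star_nm]; push_cast; noncomm_ring
        rw [f1, f2, icomm N x, ← mul_assoc (y * (v0 - (b:Hd 1))), icomm N (y * (v0 - (b:Hd 1)))]
        noncomm_ring
      rw [mul_star_nm] at this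
      have := congrArg QuaternionAlgebra.re this
      rw [QuaternionAlgebra.re_intCast, Int.cast_id] at this
      rw [this, QuaternionAlgebra.re_mul]
      simp
    exact Int.dvd_antisymm nm_nonneg hN.le d1 d2
  refine ⟨β, x * (N:Hd 1) * t + x * (b:Hd 1) * s - y * (b:Hd 1) * t - y * (c:Hd 1) * s, t, x, y, hNβ, ?_, h3, h1⟩
  have hsq := pure_sq hre
  rw [hm] at hsq
  have e1 : (N:Hd 1) * v0 = (N:Hd 1) * (t * β) + (b:Hd 1) * (s * β) := by
    rw [← h3, ← h2]; rw [mul_sub, icomm]; noncomm_ring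
  have e2 : (v0 - (b:Hd 1)) * v0 = - ((b:Hd 1) * (t * β)) - (c:Hd 1) * (s * β) := by
    rw [← h3, ← h2, sub_mul, hsq]
    have : (c : Hd 1) * (N:Hd 1) = (b:Hd 1) * (b:Hd 1) + (m:Hd 1) := by
      norm_cast; congr 1; linarith
    rw [this]; push_cast; noncomm_ring
  conv_lhs => rw [h1]
  rw [add_mul, mul_assoc, e1, mul_assoc, e2]
  noncomm_ring

lemma commute_form (v0 : Hd 1) (hre : v0.re = 0) (hp : ∃ u v w : ℤ, u*v0.imI+v*v0.imJ+w*v0.imK = 1)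
    (k : Hd 1) (h : k * v0 = v0 * k) : ∃ x y : ℤ, k = (x : Hd 1) + (y : Hd 1) * v0 := by
  obtain ⟨u, v, w, hp⟩ := hp
  have h2 := congrArg QuaternionAlgebra.imI h
  have h3 := congrArg QuaternionAlgebra.imJ h
  have h4 := congrArg QuaternionAlgebra.imK h
  simp [hre] at h2 h3 h4
  have c1 : k.imJ * v0.imK = k.imK * v0.imJ := by linarith
  have c2 : k.imI * v0.imK = k.imK * v0.imI := by linarith
  have c3 : k.imI * v0.imJ = k.imJ * v0.imI := by linarith
  refine ⟨k.re, u*k.imI+v*k.imJ+w*k.imK, ?_⟩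
  ext
  · simp [hre]
  · simp [hre]; linear_combination (-k.imI)*hp + v * c3 + w * c2
  · simp [hre]; linear_combination (-k.imJ)*hp - u * c3 + w * c1
  · simp [hre]; linear_combination (-k.imK)*hp - u * c2 - v * c1

lemma ev_inj {v0 : Hd 1} (hre : v0.re = 0) (h0 : nm v0 ≠ 0) {a b c d : ℤ}
    (h : (a : Hd 1) + (b : Hd 1) * v0 = (c : Hd 1) + (d : Hd 1) * v0) : a = c ∧ b = d := by
  have h1 := congrArg QuaternionAlgebra.re h
  have h2 := congrArg QuaternionAlgebra.imI h
  have h3 := congrArg QuaternionAlgebra.imJ h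
  have h4 := congrArg QuaternionAlgebra.imK h
  simp [hre] at h1 h2 h3 h4
  refine ⟨h1, ?_⟩
  by_contra hbd
  apply h0
  have e2 : v0.imI = 0 := by tauto
  have e3 : v0.imJ = 0 := by tauto
  have e4 : v0.imK = 0 := by tauto
  simp [nm, hre, e2, e3, e4]

lemma ev_comm {d : ℤ} (v : Hd d) (x y : ℤ) :
    ((x : Hd d) + (y : Hd d) * v) * v = v * ((x : Hd d) + (y : Hd d) * v) := by
  rw [add_mul, mul_add, icomm, ← mul_assoc v, icomm]

lemma stepC (v0 : Hd 1) (m : ℤ) (hre : v0.re = 0) (hm : nm v0 = m) (hm0 : 0 < m)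
    (hp : ∃ u v w : ℤ, u*v0.imI+v*v0.imJ+w*v0.imK = 1)
    (w0 : Hd 7) (hwre : w0.re = 0) (hwm : nm w0 = m)
    (N' b' c' : ℤ) (hc : N' * c' = b'^2 + m) (γ' κ' : Hd 7) (hγ' : nm γ' = N') (hκ' : w0 - (b' : Hd 7) = κ' * γ')
    (β' x' y' : Hd 1) (hβ' : nm β' = N') (hβxy : β' = x' * (N' : Hd 1) + y' * (v0 - (b' : Hd 1)))
    (β1 : Hd 1) (x y : ℤ) (hk : star β' * β1 = (x : Hd 1) + (y : Hd 1) * v0)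
    (hkn : nm (star β' * β1) ≠ 0) (e1 e2 : ℤ) (ε : Hd 1)
    (he : (e1 : Hd 1) + (e2 : Hd 1) * v0 = ε * β1) :
    ∃ ζ : Hd 7, (N' : Hd 7) * ((e1 : Hd 7) + (e2 : Hd 7) * w0) = ζ * γ' * ((x : Hd 7) + (y : Hd 7) * w0) := by
  have h1 : (N' : Hd 1) * ((e1 : Hd 1) + (e2 : Hd 1) * v0) = (ε * β') * ((x : Hd 1) + (y : Hd 1) * v0) := by
    rw [he, ← hk, mul_assoc ε, ← mul_assoc β', mul_star_nm, hβ', ← mul_assoc ε, icomm, mul_assoc]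
  have hcomm : (ε * β') * v0 = v0 * (ε * β') := by
    apply right_cancel' hkn
    rw [hk, mul_assoc, ← ev_comm, ← mul_assoc, ← h1, mul_assoc v0, ← h1, mul_assoc, ev_comm,
      ← mul_assoc v0, icomm, mul_assoc]
  obtain ⟨f, g, hfg⟩ := commute_form v0 hre hp _ hcomm
  have hdvd : N' ∣ f + g * b' := by
    have hst : star (v0 - (b' : Hd 1)) = ((-b' : ℤ) : Hd 1) + ((-1 : ℤ) : Hd 1) * v0 := by
      rw [star_sub, pure_star hre]
      have : star (b' : Hd 1) = b' := by ext <;> simp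
      rw [this]; push_cast; noncomm_ring
    have hnb : (v0 - (b' : Hd 1)) * star (v0 - (b' : Hd 1)) = (N' : Hd 1) * (c' : Hd 1) := by
      rw [mul_star_nm, ← Int.cast_mul]; congr 1
      rw [hc, ← hm]; simp only [nm]; simp [hre]; ring
    have e : (ε * β') * star (v0 - (b' : Hd 1)) =
        (N' : Hd 1) * (ε * x' * star (v0 - (b' : Hd 1)) + (c' : Hd 1) * (ε * y')) := by
      rw [hβxy, mul_add, add_mul, mul_assoc ε (y' * _), mul_assoc y', hnb]
      rw [← Int.cast_mul, icomm, icomm, ← mul_assoc ε, icomm, ← mul_assoc ε, icomm]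
      push_cast
      noncomm_ring
    rw [hfg, hst, ev_mul hre hm] at e
    obtain ⟨u, v, w, hp⟩ := hp
    have h2 := congrArg QuaternionAlgebra.imI e
    have h3 := congrArg QuaternionAlgebra.imJ e
    have h4 := congrArg QuaternionAlgebra.imK e
    generalize (ε * x' * (((-b' : ℤ) : Hd 1) + ((-1 : ℤ) : Hd 1) * v0) + (c' : Hd 1) * (ε * y')) = z at h2 h3 h4
    simp [hre] at h2 h3 h4
    refine ⟨-(u*z.imI+v*z.imJ+w*z.imK), ?_⟩
    linear_combination (-(f+g*b'))*hp - u * h2 - v * h3 - w * h4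
  obtain ⟨h, hh⟩ := hdvd
  rw [hfg, ev_mul hre hm] at h1
  have h1' : ((N'*e1 : ℤ) : Hd 1) + ((N' * e2 : ℤ) : Hd 1) * v0 = (N' : Hd 1) * ((e1 : Hd 1) + (e2 : Hd 1) * v0) := by
    push_cast; noncomm_ring
  rw [← h1'] at h1
  obtain ⟨q1, q2⟩ := ev_inj hre (by omega) h1
  refine ⟨(h : Hd 7) * star γ' + (g : Hd 7) * κ', ?_⟩
  have e3 : ((h : Hd 7) * star γ' + (g : Hd 7) * κ') * γ' = (f : Hd 7) + (g : Hd 7) * w0 := by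
    have hf : f = h * N' - g * b' := by linarith
    rw [add_mul, mul_assoc, star_mul_nm, mul_assoc, ← hκ', hγ', hf]
    push_cast; noncomm_ring
  rw [e3, ev_mul hwre hwm, ← q1, ← q2]
  push_cast; noncomm_ring

lemma lemmaC (v0 : Hd 1) (m : ℤ) (hre : v0.re = 0) (hm : nm v0 = m) (hm0 : 0 < m)
    (hp : ∃ u v w : ℤ, u*v0.imI+v*v0.imJ+w*v0.imK = 1)
    (w0 : Hd 7) (hwre : w0.re = 0) (hwm : nm w0 = m)
    (N b c : ℤ) (hN : 0 < N) (hc : N * c = b^2 + m) (hcop : IsCoprime N c)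
    (γ κ w : Hd 7) (hγ : nm γ = N) (hγw : γ * w0 = w * γ) (hκ : w0 - (b : Hd 7) = κ * γ)
    (β v s : Hd 1) (hβ : nm β = N) (hβv : β * v0 = v * β) (hβs : v0 - (b : Hd 1) = s * β)
    (N' b' c' : ℤ) (hN' : 0 < N') (hc' : N' * c' = b'^2 + m)
    (γ' κ' w' : Hd 7) (hγ' : nm γ' = N') (hγw' : γ' * w0 = w' * γ') (hκ' : w0 - (b' : Hd 7) = κ' * γ')
    (β' v' x' y' : Hd 1) (hβ' : nm β' = N') (hβv' : β' * v0 = v' * β')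
    (hvre' : v'.re = 0)
    (hβxy : β' = x' * (N' : Hd 1) + y' * (v0 - (b' : Hd 1)))
    (u : Hd 1) (hu : nm u = 1) (huv : u * v = v' * u) :
    ∃ δ : Hd 7, nm δ = 1 ∧ w * δ = δ * w' := by
  set β1 := u * β with hβ1
  have hb1 : β1 * v0 = v' * β1 := by rw [hβ1, mul_assoc, hβv, ← mul_assoc, huv, mul_assoc]
  have hst : star β' * v' = v0 * star β' := by
    have := congrArg star hβv'
    rw [star_mul, star_mul, pure_star hre, pure_star hvre'] at this
    simpa using this.symm
  have hkc : (star β' * β1) * v0 = v0 * (star β' * β1) := by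
    rw [mul_assoc, hb1, ← mul_assoc, hst, mul_assoc]
  have hkn : nm (star β' * β1) = N * N' := by
    rw [nm_mul, nm_star, hβ1, nm_mul, hu, hβ, hβ']; ring
  have hkn0 : nm (star β' * β1) ≠ 0 := by rw [hkn]; positivity
  obtain ⟨x, y, hk⟩ := commute_form v0 hre hp _ hkc
  have hsu : star u * u = 1 := by rw [star_mul_nm, hu]; simp
  obtain ⟨ζ1, hζ1⟩ := stepC v0 m hre hm hm0 hp w0 hwre hwm N' b' c' hc' γ' κ' hγ' hκ' β' x' y' hβ' hβxy
    β1 x y hk hkn0 N 0 (star β * star u) (by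
      rw [hβ1, mul_assoc, ← mul_assoc (star u), hsu, one_mul, star_mul_nm, hβ]; simp)
  obtain ⟨ζ2, hζ2⟩ := stepC v0 m hre hm hm0 hp w0 hwre hwm N' b' c' hc' γ' κ' hγ' hκ' β' x' y' hβ' hβxy
    β1 x y hk hkn0 (-b) 1 (s * star u) (by
      rw [hβ1, mul_assoc, ← mul_assoc (star u), hsu, one_mul, ← hβs]; push_cast; noncomm_ring)
  obtain ⟨p, q, hpq⟩ := hcop
  have hκn : nm κ = c := by
    have : nm κ * N = N * c := by
      rw [← hγ, ← nm_mul, ← hκ, hγ, hc, ← hwm]; simp only [nm]; simp [hwre]; ring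
    apply mul_left_cancel₀ hN.ne'
    linarith
  set K : Hd 7 := (x : Hd 7) + (y : Hd 7) * w0 with hK
  have hKn : nm K = N * N' := by
    have e1 : nm K = x^2 + m * y^2 := by
      rw [hK, ← hwm]; simp only [nm]; simp [hwre]; ring
    have e2 : nm (star β' * β1) = x^2 + m * y^2 := by
      rw [hk, ← hm]; simp only [nm]; simp [hre]; ring
    rw [e1, ← e2, hkn]
  have hmain : (N' : Hd 7) * γ = ((p : Hd 7) * γ * ζ1 + (q : Hd 7) * star κ * ζ2) * γ' * K := by
    have e1 : γ = (p : Hd 7) * γ * (N : Hd 7) + (q : Hd 7) * star κ * (w0 - (b : Hd 7)) := by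
      rw [hκ, mul_assoc (q : Hd 7), ← mul_assoc (star κ), star_mul_nm, hκn, icomm, ← mul_assoc, ← mul_assoc,
        ← add_mul, ← Int.cast_mul, ← Int.cast_mul, ← Int.cast_add, mul_comm N, hpq]; simp
    have e2 : (N' : Hd 7) * γ = (p : Hd 7) * γ * ((N' : Hd 7) * (N : Hd 7)) + (q : Hd 7) * star κ * ((N' : Hd 7) * (w0 - (b : Hd 7))) := by
      rw [← mul_assoc ((p : Hd 7) * γ), icomm N' ((p : Hd 7) * γ), ← mul_assoc ((q : Hd 7) * star κ),
        icomm N' ((q : Hd 7) * star κ)]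
      conv_lhs => rw [e1]
      noncomm_ring
    have e3 : (N' : Hd 7) * (N : Hd 7) = ζ1 * γ' * K := by rw [← hζ1]; simp
    have e4 : (N' : Hd 7) * (w0 - (b : Hd 7)) = ζ2 * γ' * K := by
      rw [← hζ2]; push_cast; noncomm_ring
    rw [e2, e3, e4]; noncomm_ring
  refine ⟨(p : Hd 7) * γ * ζ1 + (q : Hd 7) * star κ * ζ2, ?_, ?_⟩
  · have := congrArg nm hmain
    rw [nm_mul, nm_mul, nm_mul, nm_int, hKn, hγ, hγ'] at this
    have hne : N'^2 * N ≠ 0 := by positivity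
    apply mul_left_cancel₀ hne
    linarith
  · generalize (p : Hd 7) * γ * ζ1 + (q : Hd 7) * star κ * ζ2 = δ at *
    have hne : nm (γ' * K) ≠ 0 := by rw [nm_mul, hKn, hγ']; positivity
    apply right_cancel' hne
    have e1 : w * δ * (γ' * K) = (N' : Hd 7) * (w * γ) := by
      rw [mul_assoc w, ← mul_assoc δ, ← hmain, ← mul_assoc, icomm, mul_assoc]
    rw [e1, ← hγw, ← mul_assoc, hmain, mul_assoc, hK, ev_comm, mul_assoc δ, mul_assoc δ, ← mul_assoc γ', hγw', mul_assoc w']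

def Prim3 (a b c : ℤ) : Prop := ∀ p : ℕ, p.Prime → ¬ ((p:ℤ) ∣ a ∧ (p:ℤ) ∣ b ∧ (p:ℤ) ∣ c)

lemma sq_mod8 (x : ℤ) : (x % 2 = 1 ∧ x^2 % 8 = 1) ∨ (x % 4 = 0 ∧ x^2 % 8 = 0) ∨ (x % 4 = 2 ∧ x^2 % 8 = 4) := by
  have h : x % 8 = 0 ∨ x % 8 = 1 ∨ x % 8 = 2 ∨ x % 8 = 3 ∨ x % 8 = 4 ∨ x % 8 = 5 ∨ x % 8 = 6 ∨ x % 8 = 7 := by omega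
  have e : x^2 % 8 = (x % 8)^2 % 8 := by simp [pow_two, Int.mul_emod]
  rcases h with h | h | h | h | h | h | h | h <;> rw [h] at e <;> norm_num at e <;> omega

lemma r_parity {X A B m : ℤ} (hm : m % 8 = 1) (h : X^2+7*A^2+7*B^2 = m) :
    X % 2 = 1 ∧ A % 2 = 0 ∧ B % 2 = 0 ∧ (A - B) % 4 = 0 := by
  rcases sq_mod8 X with ⟨_, _⟩ | ⟨_, _⟩ | ⟨_, _⟩ <;> rcases sq_mod8 A with ⟨_, _⟩ | ⟨_, _⟩ | ⟨_, _⟩ <;>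
  rcases sq_mod8 B with ⟨_, _⟩ | ⟨_, _⟩ | ⟨_, _⟩ <;> omega

lemma two_sq_mod7 {a b : ℤ} (h : (7:ℤ) ∣ a^2+b^2) : (7:ℤ) ∣ a ∧ (7:ℤ) ∣ b := by
  have key : ∀ x y : ZMod 7, x^2+y^2 = 0 → x = 0 ∧ y = 0 := by decide
  have h' : ((a^2+b^2 : ℤ) : ZMod 7) = 0 := (ZMod.intCast_zmod_eq_zero_iff_dvd _ 7).2 h
  push_cast at h'
  obtain ⟨h1, h2⟩ := key _ _ h'
  exact ⟨(ZMod.intCast_zmod_eq_zero_iff_dvd a 7).1 h1, (ZMod.intCast_zmod_eq_zero_iff_dvd b 7).1 h2⟩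

lemma third_dvd {l : ℤ} (hl : Prime l) (h7 : ¬ l ∣ 7) {X A B m : ℤ} (h : X^2+7*A^2+7*B^2 = m) (hm : l ∣ m)
    (h2 : (l ∣ X ∧ l ∣ A) ∨ (l ∣ X ∧ l ∣ B) ∨ (l ∣ A ∧ l ∣ B)) : l ∣ X ∧ l ∣ A ∧ l ∣ B := by
  rcases h2 with ⟨⟨x, hx⟩, ⟨y, hy⟩⟩ | ⟨⟨x, hx⟩, ⟨y, hy⟩⟩ | ⟨⟨x, hx⟩, ⟨y, hy⟩⟩ <;> obtain ⟨z, hz⟩ := hm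
  · have : l ∣ 7 * B^2 := ⟨z - l*x^2-7*l*y^2, by subst hx hy; linear_combination h + hz⟩
    refine ⟨⟨x, hx⟩, ⟨y, hy⟩, hl.dvd_of_dvd_pow ((hl.dvd_or_dvd this).resolve_left h7)⟩
  · have : l ∣ 7 * A^2 := ⟨z - l*x^2-7*l*y^2, by subst hx hy; linear_combination h + hz⟩
    refine ⟨⟨x, hx⟩, hl.dvd_of_dvd_pow ((hl.dvd_or_dvd this).resolve_left h7), ⟨y, hy⟩⟩
  · have : l ∣ X^2 := ⟨z - 7*l*x^2-7*l*y^2, by subst hx hy; linear_combination h + hz⟩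
    refine ⟨hl.dvd_of_dvd_pow this, ⟨x, hx⟩, ⟨y, hy⟩⟩

set_option maxHeartbeats 1000000 in
lemma local_norm {p q a a' b b' m : ℤ} (hm : m % 8 = 1)
    (h1 : (p+7*q)^2+7*(a+a')^2+7*(b+b')^2 = m) (h0 : (p-7*q)^2+7*(a-a')^2+7*(b-b')^2 = m)
    (P1 : Prim3 (p+7*q) (a+a') (b+b')) (P0 : Prim3 (p-7*q) (a-a') (b-b')) (l : ℕ) (hl : l.Prime) :
    ¬ ((l:ℤ) ∣ p^2+7*a^2+7*b^2 ∧ (l:ℤ) ∣ p^2+7*a'^2+7*b'^2 ∧ (l:ℤ) ∣ a^2+b'^2+7*q^2 ∧ 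
      (l:ℤ) ∣ b^2+a'^2+7*q^2) := by
  rintro ⟨n1, n2, n3, n4⟩
  have hlZ : Prime (l:ℤ) := Nat.prime_iff_prime_int.1 hl
  by_cases h2 : l = 2
  · subst h2
    obtain ⟨c1, c2, c3, -⟩ := r_parity hm h1
    have e : ∀ x : ℤ, x^2 % 2 = x % 2 := by
      intro x; rcases Int.emod_two_eq_zero_or_one x with h | h <;> simp [pow_two, Int.mul_emod, h]
    have := e p; have := e q; have := e a; have := e b; have := e a'; have := e b'
    push_cast at n1 n2 n3 n4
    omega
  by_cases h7 : l = 7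
  · subst h7
    push_cast at *
    have d1 : (7:ℤ) ∣ p := by
      have : (7:ℤ) ∣ p^2 := by omega
      exact hlZ.dvd_of_dvd_pow this
    obtain ⟨d2, d3⟩ := two_sq_mod7 (a := a) (b := b') (by omega)
    obtain ⟨d4, d5⟩ := two_sq_mod7 (a := b) (b := a') (by omega)
    apply P1 7 hl
    push_cast
    omega
  have hl2 : ¬ (l:ℤ) ∣ 2 := by
    intro h
    have : l ∣ 2 := by exact_mod_cast h
    exact h2 ((Nat.prime_dvd_prime_iff_eq hl Nat.prime_two).1 this)
  have hl7 : ¬ (l:ℤ) ∣ 7 := by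
    intro h
    have : l ∣ 7 := by exact_mod_cast h
    exact h7 ((Nat.prime_dvd_prime_iff_eq hl (by norm_num)).1 this)
  have hl14 : ¬ (l:ℤ) ∣ 14 := by
    intro h
    rw [show (14:ℤ) = 2*7 by norm_num] at h
    rcases hlZ.dvd_or_dvd h with h | h <;> contradiction
  have orth : p*q+a*a'+b*b' = 0 := by linarith
  have d1 : (l:ℤ) ∣ (p+7*q)*(p-7*q) := by
    have : (l:ℤ) ∣ 2 * ((p+7*q)*(p-7*q)) := by
      have e : 2 * ((p+7*q)*(p-7*q)) = (p^2+7*a^2+7*b^2) + (p^2+7*a'^2+7*b'^2) - 7*(a^2+b'^2+7*q^2) - 7*(b^2+a'^2+7*q^2) := by ring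
      rw [e]
      exact dvd_sub (dvd_sub (dvd_add n1 n2) (n3.mul_left _)) (n4.mul_left _)
    exact (hlZ.dvd_or_dvd this).resolve_left hl2
  have d2 : (l:ℤ) ∣ (a+a')*(a-a') := by
    have : (l:ℤ) ∣ 14 * ((a+a')*(a-a')) := by
      have e : 14 * ((a+a')*(a-a')) = (p^2+7*a^2+7*b^2) - (p^2+7*a'^2+7*b'^2) + 7*(a^2+b'^2+7*q^2) - 7*(b^2+a'^2+7*q^2) := by ring
      rw [e]
      exact dvd_sub (dvd_add (dvd_sub n1 n2) (n3.mul_left _)) (n4.mul_left _)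
    exact (hlZ.dvd_or_dvd this).resolve_left hl14
  have d3 : (l:ℤ) ∣ (b+b')*(b-b') := by
    have : (l:ℤ) ∣ 14 * ((b+b')*(b-b')) := by
      have e : 14 * ((b+b')*(b-b')) = (p^2+7*a^2+7*b^2) - (p^2+7*a'^2+7*b'^2) - 7*(a^2+b'^2+7*q^2) + 7*(b^2+a'^2+7*q^2) := by ring
      rw [e]
      exact dvd_add (dvd_sub (dvd_sub n1 n2) (n3.mul_left _)) (n4.mul_left _)
    exact (hlZ.dvd_or_dvd this).resolve_left hl14
  have dm : (l:ℤ) ∣ m := by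
    have e : m = 2 * (p^2+7*a^2+7*b^2) - ((p+7*q)*(p-7*q) + 7*((a+a')*(a-a')) + 7*((b+b')*(b-b'))) := by
      linear_combination (-1)*h1 + 14*orth
    rw [e]
    exact dvd_sub (n1.mul_left _) (dvd_add (dvd_add d1 (d2.mul_left _)) (d3.mul_left _))
  have t1 := third_dvd hlZ hl7 h1 dm
  have t0 := third_dvd hlZ hl7 h0 dm
  have f1 := P1 l hl
  have f0 := P0 l hl
  rcases hlZ.dvd_or_dvd d1 with x1 | x1 <;> rcases hlZ.dvd_or_dvd d2 with x2 | x2 <;>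
    rcases hlZ.dvd_or_dvd d3 with x3 | x3
  · exact f1 ⟨x1, x2, x3⟩
  · exact f1 (t1 (Or.inl ⟨x1, x2⟩))
  · exact f1 (t1 (Or.inr (Or.inl ⟨x1, x3⟩)))
  · exact f0 (t0 (Or.inr (Or.inr ⟨x2, x3⟩)))
  · exact f1 (t1 (Or.inr (Or.inr ⟨x2, x3⟩)))
  · exact f0 (t0 (Or.inr (Or.inl ⟨x1, x3⟩)))
  · exact f0 (t0 (Or.inl ⟨x1, x2⟩))
  · exact f0 ⟨x1, x2, x3⟩

lemma nm_add_mul {d : ℤ} (x z : Hd d) (n : ℤ) : ∃ k, nm (x + (n : Hd d) * z) = nm x + n * k := by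
  refine ⟨2*(x.re*z.re+x.imI*z.imI+d*x.imJ*z.imJ+d*x.imK*z.imK) + n * nm z, ?_⟩
  simp only [nm]; simp; ring

lemma nm_smul {d : ℤ} (x : Hd d) (n : ℤ) : nm ((n : Hd d) * x) = n^2 * nm x := by
  rw [nm_mul, nm_int]

lemma approx (w w0 : Hd 7) 
    (hloc : ∀ l : ℕ, l.Prime → ∃ γ : Hd 7, γ * w0 = w * γ ∧ ¬ (l:ℤ) ∣ nm γ) (S : Finset ℕ) (hS : ∀ l ∈ S, l.Prime) :
    ∃ γ : Hd 7, γ * w0 = w * γ ∧ ∀ l ∈ S, ¬ (l:ℤ) ∣ nm γ := by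
  classical
  induction S using Finset.induction_on with
  | empty => exact ⟨0, by simp, by simp⟩
  | insert l S hlS ih =>
    obtain ⟨γ, h1, h2⟩ := ih (fun p hp => hS p (Finset.mem_insert_of_mem hp))
    have hl := hS l (Finset.mem_insert_self _ _)
    obtain ⟨γ1, g1, g2⟩ := hloc l hl
    have hlZ : Prime (l:ℤ) := Nat.prime_iff_prime_int.1 hl
    set M : ℕ := ∏ p ∈ S, p with hM
    have hlM : ¬ (l:ℤ) ∣ (M:ℤ) := by
      intro h
      have h : l ∣ M := by exact_mod_cast h
      rw [hM, Prime.dvd_finsetProd_iff hl.prime] at h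
      obtain ⟨p, hp, hd⟩ := h
      rw [Nat.prime_dvd_prime_iff_eq hl (hS p (Finset.mem_insert_of_mem hp))] at hd
      exact hlS (hd ▸ hp)
    refine ⟨((l:ℤ) : Hd 7) * γ + ((M:ℤ) : Hd 7) * γ1, ?_, ?_⟩
    · rw [add_mul, mul_add, mul_assoc, h1, mul_assoc, g1, ← mul_assoc w, icomm, ← mul_assoc w, icomm, mul_assoc, mul_assoc]
    · intro p hp
      rcases Finset.mem_insert.1 hp with rfl | hpS
      · rw [add_comm]
        obtain ⟨k, hk⟩ := nm_add_mul (((M:ℤ) : Hd 7) * γ1) γ (p:ℤ)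
        rw [hk, nm_smul]
        intro h
        have h := (dvd_add_left (Dvd.intro k rfl)).1 h
        rcases hlZ.dvd_or_dvd h with h | h
        · exact hlM (hlZ.dvd_of_dvd_pow h)
        · exact g2 h
      · have hp' := hS p hp
        have hpZ : Prime (p:ℤ) := Nat.prime_iff_prime_int.1 hp'
        obtain ⟨M', hM'⟩ : p ∣ M := Finset.dvd_prod_of_mem _ hpS
        have e : ((M:ℤ) : Hd 7) * γ1 = ((p:ℤ) : Hd 7) * (((M':ℤ) : Hd 7) * γ1) := by
          rw [hM']; push_cast; rw [mul_assoc]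
        rw [e]
        obtain ⟨k, hk⟩ := nm_add_mul (((l:ℤ) : Hd 7) * γ) (((M':ℤ) : Hd 7) * γ1) (p:ℤ)
        rw [hk, nm_smul]
        intro h
        have h := (dvd_add_left (Dvd.intro k rfl)).1 h
        rcases hpZ.dvd_or_dvd h with h | h
        · have h := hpZ.dvd_of_dvd_pow h
          have h : p ∣ l := by exact_mod_cast h
          rw [Nat.prime_dvd_prime_iff_eq hp' hl] at h
          exact hlS (h ▸ hpS)
        · exact h2 p hpS h

lemma bez2 (a b : ℤ) : ∃ g x y a' b' : ℤ, g = x*a+y*b ∧ a = g*a' ∧ b = g*b' := by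
  obtain ⟨a', h1⟩ := Int.gcd_dvd_left a b
  obtain ⟨b', h2⟩ := Int.gcd_dvd_right a b
  exact ⟨Int.gcd a b, Int.gcdA a b, Int.gcdB a b, a', b', by rw [Int.gcd_eq_gcd_ab]; ring, h1, h2⟩

lemma content (γ : Hd 7) (h : nm γ ≠ 0) : ∃ (g u v s t : ℤ) (γ1 : Hd 7), g ≠ 0 ∧ γ = (g : Hd 7) * γ1 ∧
    u * γ1.re + v * γ1.imI + s * γ1.imJ + t * γ1.imK = 1 := by
  obtain ⟨g1, x1, y1, a1, b1, h1, h2, h3⟩ := bez2 γ.re γ.imI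
  obtain ⟨g2, x2, y2, a2, b2, k1, k2, k3⟩ := bez2 γ.imJ γ.imK
  obtain ⟨g, x, y, a, b, l1, l2, l3⟩ := bez2 g1 g2
  have e : γ = (g : Hd 7) * (⟨a*a1, a*b1, b*a2, b*b2⟩ : Hd 7) := by
    ext
    · simp; rw [h2, l2]; ring
    · simp; rw [h3, l2]; ring
    · simp; rw [k2, l3]; ring
    · simp; rw [k3, l3]; ring
  have hg : g ≠ 0 := by
    rintro rfl
    apply h
    rw [e]; simp [nm]
  refine ⟨g, x*x1, x*y1, y*x2, y*y2, ⟨a*a1, a*b1, b*a2, b*b2⟩, hg, e, ?_⟩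
  apply mul_left_cancel₀ hg
  simp only
  have q1 : γ.re = g*(a*a1) := by rw [h2, l2]; ring
  have q2 : γ.imI = g*(a*b1) := by rw [h3, l2]; ring
  have q3 : γ.imJ = g*(b*a2) := by rw [k2, l3]; ring
  have q4 : γ.imK = g*(b*b2) := by rw [k3, l3]; ring
  rw [mul_one]
  conv_rhs => rw [l1, h1, k1, q1, q2, q3, q4]
  ring

lemma lemmaA45 (w w0 γ : Hd 7) (m N : ℤ) (hre : w0.re = 0) (hm : nm w0 = m) (wre : w.re = 0)
    (hγ : γ * w0 = w * γ) (hN : nm γ = N) (hN0 : 0 < N)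
    (hcop : IsCoprime N (14*m)) (u v s t : ℤ) 
    (hb : u * γ.re + v * γ.imI + s * γ.imJ + t * γ.imK = 1) :
    ∃ (κ : Hd 7) (b c : ℤ), w0 - (b : Hd 7) = κ * γ ∧ N * c = b^2 + m ∧ IsCoprime N c := by
  have hc14 : IsCoprime N 14 := hcop.of_mul_right_left
  have hcm : IsCoprime N m := hcop.of_mul_right_right
  obtain ⟨f, e, hfe⟩ := hc14
  set η : Hd 7 := ⟨7*e*u, 7*e*v, e*s, e*t⟩ with hη
  have hT : 1 - f * N = 2 * (star γ * η).re := by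
    simp [hη]; linear_combination (-1)*hfe - 14*e*hb
  have hx := xyx (star γ) η _ hT
  obtain ⟨b0, hb0⟩ : ∃ b0, b0 = 2 * (star γ * (w * η)).re := ⟨_, rfl⟩
  have hx2 := xyx (star γ) (w*η) _ hb0
  rw [nm_star, hN] at hx hx2
  have hst : star γ * w = w0 * star γ := by
    have := congrArg star hγ
    rw [star_mul, star_mul, pure_star hre, pure_star wre] at this
    simpa using this.symm
  set κ0 : Hd 7 := w0 * star η - star (w * η) + (f : Hd 7) * (w0 * star γ) with hκ0
  have h1 : (w0 - (b0 : Hd 7)) * star γ = (N : Hd 7) * κ0 := by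
    have e1 : star γ * (w * η) * star γ = w0 * (star γ * η * star γ) := by
      rw [← mul_assoc, hst]; noncomm_ring
    rw [hx, hx2, mul_sub, ← mul_assoc w0, icomm, ← mul_assoc w0, icomm] at e1
    rw [sub_mul, hκ0, mul_add, mul_sub]
    have : (((1 - f*N : ℤ)) : Hd 7) = 1 - (N : Hd 7) * (f : Hd 7) := by
      push_cast; rw [icomm]
    rw [this] at e1
    simp only [sub_mul, one_mul, mul_assoc] at e1
    rw [← sub_eq_zero] at e1 ⊢
    refine neg_eq_zero.1 (Eq.trans ?_ e1)
    abel
  have h2 : w0 - (b0 : Hd 7) = κ0 * γ := by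
    apply int_cancel hN0.ne'
    rw [← mul_assoc, ← h1, mul_assoc, star_mul_nm, hN, icomm]
  have hc0 : N * nm κ0 = b0^2 + m := by
    rw [← hN, mul_comm, ← nm_mul, ← h2, ← hm]; simp only [nm]; simp [hre]; ring
  set c0 := nm κ0
  have hcop2 : IsCoprime N (2*b0) := by
    have a1 : IsCoprime N 2 := by
      obtain ⟨x, y, h⟩ := hcop
      exact ⟨x, 7*m*y, by linarith⟩
    have a2 : IsCoprime N (b0*b0) := by
      obtain ⟨x, y, h⟩ := hcm
      exact ⟨x + y * c0, -y, by linear_combination h + y * hc0⟩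
    exact a1.mul_right a2.of_mul_right_left
  obtain ⟨f2, e2, h3⟩ := hcop2
  refine ⟨κ0 - ((e2*(1-c0) : ℤ) : Hd 7) * star γ, b0 + N*(e2*(1-c0)), c0 + 2*b0*(e2*(1-c0)) + N*(e2*(1-c0))^2, ?_, ?_, ?_⟩
  · rw [sub_mul, mul_assoc, star_mul_nm, ← h2, hN]
    rw [← Int.cast_mul, sub_sub, ← Int.cast_add]; congr 2; ring
  · linear_combination hc0
  · refine ⟨f2*(1-c0) - (e2*(1-c0))^2, 1, ?_⟩
    linear_combination (1-c0)*h3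

lemma lemmaA (m X A B X0 A0 B0 : ℤ) (hm : m % 8 = 1) (h1 : X^2+7*A^2+7*B^2 = m) (h0 : X0^2+7*A0^2+7*B0^2 = m)
    (P1 : Prim3 X A B) (P0 : Prim3 X0 A0 B0) (h7 : (7:ℤ) ∣ X - X0) :
    ∃ (γ κ : Hd 7) (N b c : ℤ), 0 < N ∧ N % 2 = 1 ∧ nm γ = N ∧ γ * (⟨0, X0, A0, B0⟩ : Hd 7) = (⟨0, X, A, B⟩ : Hd 7) * γ ∧
      (⟨0, X0, A0, B0⟩ : Hd 7) - (b : Hd 7) = κ * γ ∧ N * c = b^2 + m ∧ IsCoprime N c ∧ IsCoprime N m := by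
  obtain ⟨o1, o2, o3, -⟩ := r_parity hm h1
  obtain ⟨z1, z2, z3, -⟩ := r_parity hm h0
  obtain ⟨q, hq⟩ : ∃ q, X - X0 = 14 * q := ⟨(X-X0)/14, by omega⟩
  obtain ⟨a, ha⟩ : ∃ a, A + A0 = 2*a := ⟨(A+A0)/2, by omega⟩
  obtain ⟨b, hb⟩ : ∃ b, B + B0 = 2*b := ⟨(B+B0)/2, by omega⟩
  obtain ⟨p, hp⟩ : ∃ p, X + X0 = 2*p := ⟨(X+X0)/2, by omega⟩
  obtain ⟨a', ha'⟩ : ∃ a', A = a + a' := ⟨A - a, by ring⟩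
  obtain ⟨b', hb'⟩ : ∃ b', B = b + b' := ⟨B - b, by ring⟩
  have eX : X = p + 7*q := by omega
  have eX0 : X0 = p - 7*q := by omega
  have eA0 : A0 = a - a' := by omega
  have eB0 : B0 = b - b' := by omega
  clear ha hb hp hq
  subst eX eX0 eA0 eB0 ha' hb'
  have orth : p*q+a*a'+b*b' = 0 := by linarith
  set w : Hd 7 := ⟨0, p+7*q, a+a', b+b'⟩ with hw
  set w0 : Hd 7 := ⟨0, p-7*q, a-a', b-b'⟩ with hw0
  have hloc : ∀ l : ℕ, l.Prime → ∃ γ : Hd 7, γ * w0 = w * γ ∧ ¬ (l:ℤ) ∣ nm γ := by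
    intro l hl
    by_contra hcon
    push Not at hcon
    apply local_norm hm h1 h0 P1 P0 l hl
    refine ⟨?_, ?_, ?_, ?_⟩
    · have := hcon ⟨0, p, a, b⟩ (by ext <;> simp [hw, hw0] <;> first | ring1 | linear_combination 14*orth)
      simpa [nm] using this
    · have := hcon ⟨-p, 0, b', -a'⟩ (by ext <;> simp [hw, hw0] <;> first | ring1 | linear_combination 14*orth)
      simp [nm] at this
      convert this using 1; ring
    · have := hcon ⟨-a, -b', 0, q⟩ (by ext <;> simp [hw, hw0] <;> first | ring1 | linear_combination 2*orth)
      simpa [nm] using this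
    · have := hcon ⟨-b, a', -q, 0⟩ (by ext <;> simp [hw, hw0] <;> first | ring1 | linear_combination 2*orth)
      simpa [nm] using this
  have hm0 : 0 < m := by
    have : 0 ≤ m := by rw [← h1]; positivity
    omega
  obtain ⟨γ, g1, g2⟩ := approx w w0 hloc (14*m).natAbs.primeFactors (fun l hl => Nat.prime_of_mem_primeFactors hl)
  have hcopp : IsCoprime (nm γ) (14*m) := by
    rw [Int.isCoprime_iff_nat_coprime]
    apply Nat.Coprime.symm
    apply Nat.coprime_of_dvd
    intro k hk hk1 hk2
    apply g2 k
    · rw [Nat.mem_primeFactors]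
      exact ⟨hk, hk1, by simp; omega⟩
    · exact Int.natCast_dvd.2 hk2
  have hn0 : nm γ ≠ 0 := by
    intro h
    rw [h] at hcopp
    have := isCoprime_zero_left.1 hcopp
    rw [Int.isUnit_iff] at this
    omega
  obtain ⟨g, u, v, s, t, γ1, hg, hγ, hbz⟩ := content γ hn0
  have hγ1 : γ1 * w0 = w * γ1 := by
    apply int_cancel hg
    rw [← mul_assoc, ← hγ, g1, hγ, ← mul_assoc, icomm, mul_assoc]
  have hcop1 : IsCoprime (nm γ1) (14*m) := by
    rw [hγ, nm_smul] at hcopp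
    exact hcopp.of_mul_left_right
  have hpos : 0 < nm γ1 := by
    have h : 0 ≤ nm γ1 := by unfold nm; positivity
    rcases h.lt_or_eq with h | h
    · exact h
    · exfalso; apply hn0; rw [hγ, nm_smul, ← h]; ring
  obtain ⟨κ, b2, c2, k1, k2, k3⟩ := lemmaA45 w w0 γ1 m _ (by simp [hw0]) (by simp [nm, hw0]; exact h0) (by simp [hw]) hγ1 rfl hpos hcop1 u v s t hbz
  refine ⟨γ1, κ, nm γ1, b2, c2, hpos, ?_, rfl, hγ1, k1, k2, k3, hcop1.of_mul_right_right⟩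
  obtain ⟨x, y, h⟩ := hcop1
  rcases Int.emod_two_eq_zero_or_one (nm γ1) with h' | h'
  · exfalso
    obtain ⟨z, hz⟩ : (2:ℤ) ∣ nm γ1 := by omega
    rw [hz] at h
    have : 2 * (x*z + 7*(y*m)) = 1 := by linarith
    omega
  · exact h'

def Dat (v0 : Hd 1) (w0 : Hd 7) (m : ℤ) (w : Hd 7) (v : Hd 1) : Prop :=
  ∃ (N b c : ℤ) (γ κ : Hd 7) (β s x y : Hd 1), 0 < N ∧ N * c = b^2 + m ∧ IsCoprime N c ∧ IsCoprime N m ∧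
    nm γ = N ∧ γ * w0 = w * γ ∧ w0 - (b : Hd 7) = κ * γ ∧ nm β = N ∧ β * v0 = v * β ∧
    v0 - (b : Hd 1) = s * β ∧ β = x * (N : Hd 1) + y * (v0 - (b : Hd 1)) ∧ N % 2 = 1

lemma dat_exists (v0 : Hd 1) (m X A B X0 A0 B0 : ℤ) (hre : v0.re = 0) (hv : nm v0 = m)
    (hm : m % 8 = 1) (h1 : X^2+7*A^2+7*B^2 = m) (h0 : X0^2+7*A0^2+7*B0^2 = m)
    (P1 : Prim3 X A B) (P0 : Prim3 X0 A0 B0) (h7 : (7:ℤ) ∣ X - X0) :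
    ∃ v, Dat v0 ⟨0, X0, A0, B0⟩ m ⟨0, X, A, B⟩ v := by
  obtain ⟨γ, κ, N, b, c, a1, a2, a3, a4, a5, a6, a7, a8⟩ := lemmaA m X A B X0 A0 B0 hm h1 h0 P1 P0 h7
  obtain ⟨β, v, s, x, y, b1, b2, b3, b4⟩ := lemmaB v0 m N b c hre hv a1 a2 a6 a7
  exact ⟨v, N, b, c, γ, κ, β, s, x, y, a1, a6, a7, a8, a3, a4, a5, b1, b2, b3, b4, a2⟩

lemma dat_v {v0 : Hd 1} {w0 w : Hd 7} {m : ℤ} {v : Hd 1} (hre : v0.re = 0) (hv : nm v0 = m)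
    (hp : ∃ u v w : ℤ, u*v0.imI+v*v0.imJ+w*v0.imK = 1) (hodd : v0.imI % 2 = 1)
    (h : Dat v0 w0 m w v) : v.re = 0 ∧ nm v = m ∧ v.imI % 2 = 1 ∧ Prim3 v.imI v.imJ v.imK := by
  obtain ⟨N, b, c, γ, κ, β, s, x, y, hN, -, -, hNm, -, -, -, hβ, hβv, -, -, hN2⟩ := h
  have e : (N : Hd 1) * v = β * v0 * star β := by
    rw [hβv, mul_assoc, mul_star_nm, hβ, icomm]
  have e' : (N : Hd 1) * v0 = star β * v * β := by
    rw [mul_assoc, ← hβv, ← mul_assoc, star_mul_nm, hβ]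
  have hnv : nm v = m := by
    have := congrArg nm hβv
    rw [nm_mul, nm_mul, hβ, hv] at this
    apply mul_left_cancel₀ hN.ne'
    linarith
  refine ⟨?_, hnv, ?_, ?_⟩
  · have h1 := congrArg QuaternionAlgebra.re e
    simp [hre] at h1
    have h2 : N * v.re = 0 := by rw [h1]; ring
    rcases mul_eq_zero.1 h2 with h | h
    · omega
    · exact h
  · have h1 := congrArg QuaternionAlgebra.imI e
    simp [hre] at h1
    have hb : N = β.re^2 + β.imI^2 + β.imJ^2 + β.imK^2 := by rw [← hβ, nm]; ring
    obtain ⟨k, hk⟩ : ∃ k, N * v.imI = N * v0.imI + 2 * k := by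
      refine ⟨-(β.imJ^2+β.imK^2)*v0.imI + (β.imI*β.imJ - β.re*β.imK)*v0.imJ + (β.imI*β.imK+β.re*β.imJ)*v0.imK, ?_⟩
      rw [h1, hb]; ring
    have h3 := congrArg (· % 2) hk
    simp only [Int.add_mul_emod_self_left] at h3
    rw [Int.mul_emod, hN2, Int.mul_emod N, hN2, hodd] at h3
    omega
  · rintro p hpp ⟨⟨a1, h1⟩, ⟨a2, h2⟩, ⟨a3, h3⟩⟩
    have hpZ : Prime (p:ℤ) := Nat.prime_iff_prime_int.1 hpp
    have hre' : v.re = 0 := by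
      have h1 := congrArg QuaternionAlgebra.re e
      simp [hre] at h1
      have h2 : N * v.re = 0 := by rw [h1]; ring
      rcases mul_eq_zero.1 h2 with h | h
      · omega
      · exact h
    have hv' : v = ((p:ℤ) : Hd 1) * (⟨0, a1, a2, a3⟩ : Hd 1) := by
      ext
      · simp [hre']
      · simpa using h1
      · simpa using h2
      · simpa using h3
    have hpm : (p:ℤ) ∣ m := by
      rw [← hnv, hv', nm_smul, pow_two, mul_assoc]; exact Dvd.intro _ rfl
    have hpN : (p:ℤ) ∣ N := by
      rw [hv', ← mul_assoc, icomm, mul_assoc, mul_assoc] at e'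
      generalize star β * ((⟨0, a1, a2, a3⟩ : Hd 1) * β) = z at e'
      obtain ⟨u, v, w, hp⟩ := hp
      have g2 := congrArg QuaternionAlgebra.imI e'
      have g3 := congrArg QuaternionAlgebra.imJ e'
      have g4 := congrArg QuaternionAlgebra.imK e'
      simp at g2 g3 g4
      refine ⟨u*z.imI+v*z.imJ+w*z.imK, ?_⟩
      linear_combination (-N)*hp + u*g2+v*g3+w*g4
    exact hpZ.not_isUnit (hNm.isUnit_of_dvd' hpN hpm)

lemma dat_inj {v0 : Hd 1} {w0 w w' : Hd 7} {m : ℤ} {v v' : Hd 1} (hre : v0.re = 0) (hv : nm v0 = m) (hm0 : 0 < m)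
    (hp : ∃ u v w : ℤ, u*v0.imI+v*v0.imJ+w*v0.imK = 1) (hwre : w0.re = 0) (hwm : nm w0 = m) (hvre' : v'.re = 0)
    (h : Dat v0 w0 m w v) (h' : Dat v0 w0 m w' v') (u : Hd 1) (hu : nm u = 1) (huv : u * v = v' * u) :
    ∃ δ : Hd 7, nm δ = 1 ∧ w * δ = δ * w' := by
  obtain ⟨N, b, c, γ, κ, β, s, x, y, a1, a2, a3, a4, a5, a6, a7, a8, a9, a10, a11, a12⟩ := h
  obtain ⟨N', b', c', γ', κ', β', s', x', y', b1, b2, b3, b4, b5, b6, b7, b8, b9, b10, b11, b12⟩ := h'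
  exact lemmaC v0 m hre hv hm0 hp w0 hwre hwm N b c a1 a2 a3 γ κ w a5 a6 a7 β v s a8 a9 a10
    N' b' c' b1 b2 γ' κ' w' b5 b6 b7 β' v' x' y' b8 b9 hvre' b11 u hu huv

lemma unit7 {δ : Hd 7} (h : nm δ = 1) {X A B X' A' B' : ℤ}
    (hc : (⟨0, X, A, B⟩ : Hd 7) * δ = δ * (⟨0, X', A', B'⟩ : Hd 7)) :
    (X' = X ∧ A' = A ∧ B' = B) ∨ (X' = X ∧ A' = -A ∧ B' = -B) := by
  unfold nm at h
  have hJ : δ.imJ = 0 := by nlinarith [sq_nonneg δ.re, sq_nonneg δ.imI, sq_nonneg δ.imJ, sq_nonneg δ.imK, Int.one_le_abs (z := δ.imJ), sq_abs δ.imJ]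
  have hK : δ.imK = 0 := by nlinarith [sq_nonneg δ.re, sq_nonneg δ.imI, sq_nonneg δ.imJ, sq_nonneg δ.imK, Int.one_le_abs (z := δ.imK), sq_abs δ.imK]
  have g1 := congrArg QuaternionAlgebra.re hc
  have g2 := congrArg QuaternionAlgebra.imI hc
  have g3 := congrArg QuaternionAlgebra.imJ hc
  have g4 := congrArg QuaternionAlgebra.imK hc
  simp [hJ, hK] at g1 g2 g3 g4 h
  have hr : δ.re = 0 ∨ δ.re = 1 ∨ δ.re = -1 := by
    have : δ.re ≤ 1 := by nlinarith [sq_nonneg δ.imI]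
    have : -1 ≤ δ.re := by nlinarith [sq_nonneg δ.imI]
    omega
  rcases hr with hr | hr | hr
  · have : δ.imI = 1 ∨ δ.imI = -1 := by
      rw [hr] at h
      rcases mul_eq_zero.1 (show (δ.imI-1)*(δ.imI+1) = 0 by linarith) with h | h <;> omega
    rcases this with hi | hi <;> simp [hr, hi] at g1 g2 g3 g4 <;> right <;> omega
  all_goals
    have : δ.imI = 0 := by
      rw [hr] at h; nlinarith
    simp [hr, this] at g1 g2 g3 g4; left; omega

def act : Fin 4 → ℤ × ℤ × ℤ → ℤ × ℤ × ℤ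
  | 0, p => p
  | 1, p => (p.1, -p.2.1, -p.2.2)
  | 2, p => (-p.1, p.2.1, -p.2.2)
  | 3, p => (-p.1, -p.2.1, p.2.2)

def unt : Fin 4 → Hd 1
  | 0 => ⟨1, 0, 0, 0⟩
  | 1 => ⟨0, 1, 0, 0⟩
  | 2 => ⟨0, 0, 1, 0⟩
  | 3 => ⟨0, 0, 0, 1⟩

def toH (d : ℤ) (p : ℤ × ℤ × ℤ) : Hd d := ⟨0, p.1, p.2.1, p.2.2⟩

lemma unt_nm (g : Fin 4) : nm (unt g) = 1 := by fin_cases g <;> simp [unt, nm]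

lemma unt_act (g : Fin 4) (p : ℤ × ℤ × ℤ) : unt g * toH 1 p = toH 1 (act g p) * unt g := by
  fin_cases g <;> ext <;> simp [unt, toH, act]

lemma unt_rel {g g' : Fin 4} {p p' : ℤ × ℤ × ℤ} (h : act g p = act g' p') :
    ∃ u : Hd 1, nm u = 1 ∧ u * toH 1 p = toH 1 p' * u := by
  refine ⟨star (unt g') * unt g, by rw [nm_mul, nm_star, unt_nm, unt_nm]; norm_num, ?_⟩
  have h1 : star (unt g') * unt g' = 1 := by rw [star_mul_nm, unt_nm]; simp
  have h2 : unt g' * star (unt g') = 1 := by rw [mul_star_nm, unt_nm]; simp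
  have h3 : star (unt g') * toH 1 (act g' p') = toH 1 p' * star (unt g') := by
    have e := congrArg (fun z => star (unt g') * z * star (unt g')) (unt_act g' p')
    rw [← mul_assoc, h1, one_mul, mul_assoc, mul_assoc (toH 1 (act g' p')), h2, mul_one] at e
    exact e.symm
  rw [mul_assoc, unt_act, h, ← mul_assoc, h3, mul_assoc]

lemma act_free {g g' : Fin 4} {p : ℤ × ℤ × ℤ} (h1 : p.1 ≠ 0) (h2 : p.2.1 ≠ 0 ∨ p.2.2 ≠ 0)
    (h : act g p = act g' p) : g = g' := by
  obtain ⟨x, y, z⟩ := p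
  simp only at h1 h2
  fin_cases g <;> fin_cases g' <;> simp [act] at h ⊢ <;> omega

noncomputable def box (m : ℤ) : Finset (ℤ × ℤ × ℤ) := Finset.Icc (-m) m ×ˢ Finset.Icc (-m) m ×ˢ Finset.Icc (-m) m

noncomputable def RF (m : ℤ) : Finset (ℤ × ℤ × ℤ) := (box m).filter (fun p => p.1^2+7*p.2.1^2+7*p.2.2^2 = m)
noncomputable def SF (m : ℤ) : Finset (ℤ × ℤ × ℤ) := (box m).filter (fun p => p.1^2+p.2.1^2+p.2.2^2 = m ∧ p.1 % 2 = 1)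

lemma sq_bd {x m : ℤ} (h : x^2 ≤ m) : -m ≤ x ∧ x ≤ m := by
  constructor
  · rcases le_or_gt 0 x with h' | h' <;> nlinarith
  · rcases le_or_gt 0 x with h' | h' <;> nlinarith

lemma mem_RF {m : ℤ} {p : ℤ × ℤ × ℤ} : p ∈ RF m ↔ p.1^2+7*p.2.1^2+7*p.2.2^2 = m := by
  simp only [RF, box, Finset.mem_filter, Finset.mem_product, Finset.mem_Icc, and_iff_right_iff_imp]
  intro h
  have a := sq_nonneg p.1
  have b := sq_nonneg p.2.1
  have c := sq_nonneg p.2.2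
  exact ⟨sq_bd (by linarith), sq_bd (by linarith), sq_bd (by linarith)⟩

lemma mem_SF {m : ℤ} {p : ℤ × ℤ × ℤ} : p ∈ SF m ↔ p.1^2+p.2.1^2+p.2.2^2 = m ∧ p.1 % 2 = 1 := by
  simp only [SF, box, Finset.mem_filter, Finset.mem_product, Finset.mem_Icc, and_iff_right_iff_imp]
  rintro ⟨h, -⟩
  have a := sq_nonneg p.1
  have b := sq_nonneg p.2.1
  have c := sq_nonneg p.2.2
  exact ⟨sq_bd (by linarith), sq_bd (by linarith), sq_bd (by linarith)⟩

def PR (p : ℤ × ℤ × ℤ) : Prop := Prim3 p.1 p.2.1 p.2.2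

open Classical in
noncomputable def RP (m : ℤ) : Finset (ℤ × ℤ × ℤ) := (RF m).filter PR
open Classical in
noncomputable def SP (m : ℤ) : Finset (ℤ × ℤ × ℤ) := (SF m).filter PR

lemma mem_RP {m : ℤ} {p : ℤ × ℤ × ℤ} : p ∈ RP m ↔ p.1^2+7*p.2.1^2+7*p.2.2^2 = m ∧ PR p := by
  simp [RP, mem_RF]
lemma mem_SP {m : ℤ} {p : ℤ × ℤ × ℤ} : p ∈ SP m ↔ (p.1^2+p.2.1^2+p.2.2^2 = m ∧ p.1 % 2 = 1) ∧ PR p := by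
  simp [SP, mem_SF]

lemma act_SP {m : ℤ} {p : ℤ × ℤ × ℤ} (h : p ∈ SP m) (g : Fin 4) : act g p ∈ SP m := by
  rw [mem_SP] at *
  obtain ⟨⟨h1, h2⟩, h3⟩ := h
  fin_cases g <;> simp [act, PR, Prim3] at * <;> refine ⟨⟨h1, by omega⟩, h3⟩

lemma SP_free {m : ℤ} (hm : 1 < m) {p : ℤ × ℤ × ℤ} (h : p ∈ SP m) : p.1 ≠ 0 ∧ (p.2.1 ≠ 0 ∨ p.2.2 ≠ 0) := by
  rw [mem_SP] at h
  obtain ⟨⟨h1, h2⟩, h3⟩ := h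
  refine ⟨by omega, ?_⟩
  by_contra hcon
  push Not at hcon
  obtain ⟨hy, hz⟩ := hcon
  rw [hy, hz] at h1
  have h4 : p.1.natAbs ≠ 1 := by
    intro h
    have := Int.natAbs_sq p.1
    rw [h] at this
    norm_num at this
    omega
  obtain ⟨q, hq, hd⟩ := Nat.exists_prime_and_dvd h4
  exact h3 q hq ⟨Int.natCast_dvd.2 hd, by simp [hy], by simp [hz]⟩

lemma exists_v0 {m : ℤ} (hm0 : 0 < m) (hm : m % 8 = 1) : ∃ v0 : Hd 1, v0.re = 0 ∧ nm v0 = m ∧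
    (∃ u v w : ℤ, u*v0.imI+v*v0.imJ+w*v0.imK = 1) ∧ v0.imI % 2 = 1 := by
  obtain ⟨x, y, z, u, v, w, h1, h2⟩ := three_squares m.toNat (by omega)
  have h1 : x^2+y^2+z^2 = m := by rw [h1]; omega
  have e : ∀ x : ℤ, x^2 % 2 = x % 2 := by
    intro x; rcases Int.emod_two_eq_zero_or_one x with h | h <;> simp [pow_two, Int.mul_emod, h]
  have ex := e x; have ey := e y; have ez := e z
  have : x % 2 = 1 ∨ y % 2 = 1 ∨ z % 2 = 1 := by omega
  rcases this with h | h | h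
  · exact ⟨⟨0, x, y, z⟩, rfl, by simp [nm]; linarith, ⟨u, v, w, h2⟩, h⟩
  · exact ⟨⟨0, y, x, z⟩, rfl, by simp [nm]; linarith, ⟨v, u, w, by simp; linarith⟩, h⟩
  · exact ⟨⟨0, z, y, x⟩, rfl, by simp [nm]; linarith, ⟨w, v, u, by simp; linarith⟩, h⟩

open Classical in
lemma plus_count {m : ℤ} (hm1 : 1 < m) (hm : m % 8 = 1) {w0 : ℤ × ℤ × ℤ} (hw0 : w0 ∈ RP m) :
    ((RP m).filter (fun p => (7:ℤ) ∣ p.1 - w0.1)).card * 4 ≤ 2 * (SP m).card := by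
  obtain ⟨v0, hre, hv, hp, hodd⟩ := exists_v0 (by omega) hm
  rw [mem_RP] at hw0
  set Rp := (RP m).filter (fun p => (7:ℤ) ∣ p.1 - w0.1) with hRp
  have hex : ∀ p : ℤ × ℤ × ℤ, ∃ v : ℤ × ℤ × ℤ, p ∈ Rp → Dat v0 (toH 7 w0) m (toH 7 p) (toH 1 v) ∧ v ∈ SP m := by
    intro p
    by_cases h : p ∈ Rp
    · have h' := h
      rw [hRp, Finset.mem_filter, mem_RP] at h'
      obtain ⟨v, hv1⟩ := dat_exists v0 m p.1 p.2.1 p.2.2 w0.1 w0.2.1 w0.2.2 hre hv hm h'.1.1 hw0.1 h'.1.2 hw0.2 h'.2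
      obtain ⟨q1, q2, q3, q4⟩ := dat_v hre hv hp hodd hv1
      have e : v = toH 1 (v.imI, v.imJ, v.imK) := by ext <;> simp [toH, q1]
      refine ⟨(v.imI, v.imJ, v.imK), fun _ => ⟨?_, ?_⟩⟩
      · rw [← e]; exact hv1
      · rw [mem_SP]
        refine ⟨⟨?_, q3⟩, q4⟩
        rw [nm, q1] at q2
        simp only
        linarith
    · exact ⟨0, fun h' => absurd h' h⟩
  choose Φ hΦ using hex
  have key := Finset.card_le_mul_card_image_of_maps_to (s := Rp ×ˢ (Finset.univ : Finset (Fin 4))) (t := SP m)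
    (f := fun a => act a.2 (Φ a.1)) (by
      intro a ha
      rw [Finset.mem_product] at ha
      exact act_SP (hΦ _ ha.1).2 _) 2 (by
      intro t ht
      rcases Finset.eq_empty_or_nonempty ((Rp ×ˢ (Finset.univ : Finset (Fin 4))).filter (fun a => act a.2 (Φ a.1) = t)) with h | ⟨⟨w1, g1⟩, h1⟩
      · rw [h]; simp
      rw [Finset.mem_filter, Finset.mem_product] at h1
      obtain ⟨⟨h1, -⟩, h2⟩ := h1
      simp only at h1 h2
      calc _ ≤ ({w1, (w1.1, -w1.2.1, -w1.2.2)} : Finset (ℤ × ℤ × ℤ)).card := ?_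
        _ ≤ 2 := Finset.card_le_two
      apply Finset.card_le_card_of_injOn Prod.fst
      · rintro ⟨w2, g2⟩ h3
        rw [Finset.mem_coe, Finset.mem_filter, Finset.mem_product] at h3
        obtain ⟨⟨h3, -⟩, h4⟩ := h3
        simp only at h3 h4 ⊢
        obtain ⟨u, hu, huv⟩ := unt_rel (h2.trans h4.symm)
        obtain ⟨δ, d1, d2⟩ := dat_inj hre hv (by omega) hp (by simp [toH]) (by simp [toH, nm]; exact hw0.1) (by simp [toH])
          (hΦ _ h1).1 (hΦ _ h3).1 u hu huv
        have := unit7 d1 d2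
        simp only [Finset.coe_insert, Finset.coe_singleton, Set.mem_insert_iff, Set.mem_singleton_iff]
        obtain ⟨x2, y2, z2⟩ := w2
        obtain ⟨x1, y1, z1⟩ := w1
        simp only [Prod.mk.injEq] at this ⊢
        exact this
      · rintro ⟨w2, g2⟩ h3 ⟨w3, g3⟩ h5 h6
        simp only at h6
        subst h6
        rw [Finset.mem_coe, Finset.mem_filter, Finset.mem_product] at h3 h5
        have hs := SP_free hm1 (hΦ _ h3.1.1).2
        have := act_free hs.1 hs.2 (h3.2.trans h5.2.symm)
        simp only at this
        rw [this])
  rw [Finset.card_product] at key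
  simpa using key

lemma prim_count {m : ℤ} (hm0 : 0 < m) (hm : m % 8 = 1) : (RP m).card ≤ (SP m).card := by
  classical
  rcases (show m = 1 ∨ 1 < m by omega) with h1 | h1
  · subst h1
    apply Finset.card_le_card
    intro p hp
    rw [mem_RP] at hp
    rw [mem_SP]
    obtain ⟨h, h'⟩ := hp
    obtain ⟨o, -⟩ := r_parity hm h
    have a := sq_nonneg p.1
    have b := sq_nonneg p.2.1
    have c := sq_nonneg p.2.2
    refine ⟨⟨by omega, o⟩, h'⟩
  rcases Finset.eq_empty_or_nonempty (RP m) with h | ⟨w0, hw0⟩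
  · rw [h]; simp
  have k1 := plus_count h1 hm hw0
  have k2 : ((RP m).filter (fun p => (7:ℤ) ∣ p.1 + w0.1)).card ≤ ((RP m).filter (fun p => (7:ℤ) ∣ p.1 - w0.1)).card := by
    apply Finset.card_le_card_of_injOn (fun p => (-p.1, p.2))
    · intro p hp
      simp only [Finset.coe_filter, Set.mem_ofPred_eq, mem_RP, PR, Prim3] at hp ⊢
      obtain ⟨⟨h2, h3⟩, h4⟩ := hp
      refine ⟨⟨by simpa using h2, by simpa using h3⟩, by omega⟩
    · rintro ⟨x, y⟩ _ ⟨x', y'⟩ _ h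
      simpa using h
  have k3 : RP m ⊆ (RP m).filter (fun p => (7:ℤ) ∣ p.1 - w0.1) ∪ (RP m).filter (fun p => (7:ℤ) ∣ p.1 + w0.1) := by
    intro p hp
    have hp' := hp
    rw [mem_RP] at hp' hw0
    have : (7:ℤ) ∣ (p.1 - w0.1) * (p.1 + w0.1) :=
      ⟨w0.2.1^2 + w0.2.2^2 - p.2.1^2 - p.2.2^2, by linear_combination hp'.1 - hw0.1⟩
    have h7 : Prime (7:ℤ) := by norm_num
    rw [Finset.mem_union, Finset.mem_filter, Finset.mem_filter]
    rcases h7.dvd_or_dvd this with h | h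
    · left; exact ⟨hp, h⟩
    · right; exact ⟨hp, h⟩
  have k4 := Finset.card_le_card k3
  have k5 := Finset.card_union_le ((RP m).filter (fun p => (7:ℤ) ∣ p.1 - w0.1)) ((RP m).filter (fun p => (7:ℤ) ∣ p.1 + w0.1))
  omega

def g3 (p : ℤ × ℤ × ℤ) : ℕ := Int.gcd p.1 (Int.gcd p.2.1 p.2.2)

def sc (c : ℤ) (p : ℤ × ℤ × ℤ) : ℤ × ℤ × ℤ := (c * p.1, c * p.2.1, c * p.2.2)

lemma sc_inj {c : ℤ} (hc : c ≠ 0) : Function.Injective (sc c) := by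
  rintro ⟨x, y, z⟩ ⟨x', y', z'⟩ h
  simpa [sc, hc] using h

lemma g3_sc (c : ℕ) (p : ℤ × ℤ × ℤ) : g3 (sc c p) = c * g3 p := by
  unfold g3 sc
  simp only
  rw [Int.gcd_mul_left, Int.natAbs_natCast, Nat.cast_mul, Int.gcd_mul_left, Int.natAbs_natCast]

lemma PR_iff (p : ℤ × ℤ × ℤ) : PR p ↔ g3 p = 1 := by
  constructor
  · intro h
    by_contra hne
    obtain ⟨q, hq, hd⟩ := Nat.exists_prime_and_dvd hne
    have hd' : (q:ℤ) ∣ (g3 p : ℤ) := by exact_mod_cast hd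
    have h1 : (q:ℤ) ∣ p.1 := hd'.trans (Int.gcd_dvd_left ..)
    have h2 : (q:ℤ) ∣ (Int.gcd p.2.1 p.2.2 : ℤ) := hd'.trans (Int.gcd_dvd_right ..)
    exact h q hq ⟨h1, h2.trans (Int.gcd_dvd_left ..), h2.trans (Int.gcd_dvd_right ..)⟩
  · rintro h q hq ⟨h1, h2, h3⟩
    have : (q:ℤ) ∣ (g3 p : ℤ) := Int.dvd_coe_gcd h1 (Int.dvd_coe_gcd h2 h3)
    rw [h] at this
    have : q ∣ 1 := by exact_mod_cast this
    exact hq.one_lt.ne' (Nat.dvd_one.1 this)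

lemma g3_factor {p : ℤ × ℤ × ℤ} {c : ℕ} (hc : c ≠ 0) (h : g3 p = c) : ∃ q, PR q ∧ p = sc c q := by
  have hd' : (c:ℤ) ∣ (g3 p : ℤ) := by rw [h]
  obtain ⟨a, h1⟩ : (c:ℤ) ∣ p.1 := hd'.trans (Int.gcd_dvd_left ..)
  have h2 : (c:ℤ) ∣ (Int.gcd p.2.1 p.2.2 : ℤ) := hd'.trans (Int.gcd_dvd_right ..)
  obtain ⟨b, h3⟩ := h2.trans (Int.gcd_dvd_left ..)
  obtain ⟨d, h4⟩ := h2.trans (Int.gcd_dvd_right ..)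
  have e : p = sc c (a, b, d) := by
    obtain ⟨x, y, z⟩ := p
    simp only [sc] at *
    rw [h1, h3, h4]
  refine ⟨(a, b, d), ?_, e⟩
  rw [PR_iff]
  rw [e, g3_sc] at h
  have : c * g3 (a, b, d) = c * 1 := by omega
  exact Nat.eq_of_mul_eq_mul_left (Nat.pos_of_ne_zero hc) this

lemma full_count {m : ℤ} (hm0 : 0 < m) (hm : m % 8 = 1) : (RF m).card ≤ (SF m).card := by
  classical
  rw [Finset.card_eq_sum_card_fiberwise (s := RF m) (t := (RF m).image g3 ∪ (SF m).image g3) (f := g3) (by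
      intro p hp; simp only [Finset.coe_union, Finset.coe_image]; left; exact ⟨p, hp, rfl⟩),
    Finset.card_eq_sum_card_fiberwise (s := SF m) (t := (RF m).image g3 ∪ (SF m).image g3) (f := g3) (by
      intro p hp; simp only [Finset.coe_union, Finset.coe_image]; right; exact ⟨p, hp, rfl⟩)]
  apply Finset.sum_le_sum
  intro c _
  rcases Finset.eq_empty_or_nonempty ((RF m).filter (fun p => g3 p = c)) with h | ⟨p, hp⟩
  · rw [h]; simp
  rw [Finset.mem_filter, mem_RF] at hp
  have hc0 : c ≠ 0 := by
    rintro rfl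
    have h2 := hp.2
    simp only [g3, Int.gcd_eq_zero_iff] at h2
    obtain ⟨h2, h3⟩ := h2
    have h3 : Int.gcd p.2.1 p.2.2 = 0 := by exact_mod_cast h3
    rw [Int.gcd_eq_zero_iff] at h3
    rw [h2, h3.1, h3.2] at hp
    have := hp.1
    norm_num at this
    omega
  obtain ⟨q, hq, hpq⟩ := g3_factor hc0 hp.2
  obtain ⟨m1, hm1⟩ : ∃ m1, m1 = q.1^2+7*q.2.1^2+7*q.2.2^2 := ⟨_, rfl⟩
  have hmm : m = c^2 * m1 := by
    rw [← hp.1, hpq, hm1]; simp only [sc]; ring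
  have hcodd : (c:ℤ) % 2 = 1 := by
    rcases Int.emod_two_eq_zero_or_one (c:ℤ) with h | h
    · exfalso
      obtain ⟨k, hk⟩ : (2:ℤ) ∣ c := by omega
      rw [hk] at hmm
      have : m = 2 * (2*k^2*m1) := by rw [hmm]; ring
      omega
    · exact h
  have hc2 : (c:ℤ)^2 % 8 = 1 := by
    rcases sq_mod8 (c:ℤ) with ⟨h, h'⟩ | ⟨h, h'⟩ | ⟨h, h'⟩ <;> omega
  have hm18 : m1 % 8 = 1 := by
    rw [hmm, Int.mul_emod, hc2] at hm
    omega
  have hm10 : 0 < m1 := by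
    have : 0 ≤ m1 := by rw [hm1]; positivity
    omega
  have hcZ : (c:ℤ) ≠ 0 := by exact_mod_cast hc0
  calc ((RF m).filter (fun p => g3 p = c)).card ≤ ((RP m1).image (sc c)).card := by
        apply Finset.card_le_card
        intro r hr
        rw [Finset.mem_filter, mem_RF] at hr
        obtain ⟨s, hs, hrs⟩ := g3_factor hc0 hr.2
        rw [Finset.mem_image]
        refine ⟨s, ?_, hrs.symm⟩
        rw [mem_RP]
        refine ⟨?_, hs⟩
        have := hr.1
        rw [hrs, hmm] at this
        simp only [sc] at this
        apply mul_left_cancel₀ (pow_ne_zero 2 hcZ)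
        linarith
    _ ≤ (RP m1).card := Finset.card_image_le
    _ ≤ (SP m1).card := prim_count hm10 hm18
    _ = ((SP m1).image (sc c)).card := (Finset.card_image_of_injective _ (sc_inj hcZ)).symm
    _ ≤ _ := by
        apply Finset.card_le_card
        intro r hr
        rw [Finset.mem_image] at hr
        obtain ⟨s, hs, rfl⟩ := hr
        rw [mem_SP, PR_iff] at hs
        rw [Finset.mem_filter, mem_SF, g3_sc, hs.2]
        refine ⟨⟨?_, ?_⟩, by ring⟩
        · rw [hmm, ← hs.1.1]; simp only [sc]; ring
        · simp only [sc]; rw [Int.mul_emod, hcodd, hs.1.2]; norm_num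

def ff (p : ℤ × ℤ × ℤ) : ℤ × ℤ × ℤ := (2*p.1+1, 2*p.2.1+2*p.2.2, 2*p.2.1-2*p.2.2)

lemma ff_inj : Function.Injective ff := by
  rintro ⟨x, y, z⟩ ⟨x', y', z'⟩ h
  simp [ff] at h ⊢
  omega

lemma tri (x : ℤ) : ∃ t, x*(x+1)/2 = t ∧ x^2+x = 2*t := by
  obtain ⟨t, ht⟩ := Int.even_mul_succ_self x
  exact ⟨t, by omega, by linarith⟩

lemma s_parity {X Y Z m : ℤ} (hm : m % 8 = 1) (hX : X % 2 = 1) (h : X^2+Y^2+Z^2 = m) :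
    Y % 2 = 0 ∧ Z % 2 = 0 ∧ (Y - Z) % 4 = 0 := by
  rcases sq_mod8 X with ⟨_, _⟩ | ⟨_, _⟩ | ⟨_, _⟩ <;> rcases sq_mod8 Y with ⟨_, _⟩ | ⟨_, _⟩ | ⟨_, _⟩ <;>
  rcases sq_mod8 Z with ⟨_, _⟩ | ⟨_, _⟩ | ⟨_, _⟩ <;> omega

theorem triangular_square_count_ge (n : ℕ) :
    {p : ℤ × ℤ × ℤ | (n : ℤ) = p.1 * (p.1 + 1) / 2 + p.2.1 ^ 2 + p.2.2 ^ 2}.ncard ≥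
    {p : ℤ × ℤ × ℤ | (n : ℤ) = p.1 * (p.1 + 1) / 2 + 7 * p.2.1 ^ 2 + 7 * p.2.2 ^ 2}.ncard := by
  have hmain := full_count (m := 8*n+1) (by positivity) (by omega)
  rw [ge_iff_le]
  calc _ = (ff '' {p : ℤ × ℤ × ℤ | (n : ℤ) = p.1 * (p.1 + 1) / 2 + 7 * p.2.1 ^ 2 + 7 * p.2.2 ^ 2}).ncard :=
        (Set.ncard_image_of_injective _ ff_inj).symm
    _ ≤ ((RF (8*n+1) : Finset (ℤ × ℤ × ℤ)) : Set (ℤ × ℤ × ℤ)).ncard := by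
        apply Set.ncard_le_ncard _ (Finset.finite_toSet _)
        rintro _ ⟨⟨x, y, z⟩, hp, rfl⟩
        change (n:ℤ) = x*(x+1)/2+7*y^2+7*z^2 at hp
        rw [Finset.mem_coe, mem_RF]
        obtain ⟨t, h1, h2⟩ := tri x
        rw [h1] at hp
        simp only [ff]
        linear_combination 4*h2 - 8*hp
    _ ≤ ((SF (8*n+1) : Finset (ℤ × ℤ × ℤ)) : Set (ℤ × ℤ × ℤ)).ncard := by
        rw [Set.ncard_coe_finset, Set.ncard_coe_finset]; exact hmain
    _ = (ff '' {p : ℤ × ℤ × ℤ | (n : ℤ) = p.1 * (p.1 + 1) / 2 + p.2.1 ^ 2 + p.2.2 ^ 2}).ncard := by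
        congr 1
        ext p
        obtain ⟨X, Y, Z⟩ := p
        rw [Finset.mem_coe, mem_SF]
        constructor
        · rintro ⟨h1, h2⟩
          simp only at h1 h2
          obtain ⟨a, b, c⟩ := s_parity (m := 8*n+1) (by omega) h2 h1
          obtain ⟨x, hx⟩ : ∃ x, X = 2*x+1 := ⟨X/2, by omega⟩
          obtain ⟨y, hy⟩ : ∃ y, Y + Z = 4*y := ⟨(Y+Z)/4, by omega⟩
          obtain ⟨z, hz⟩ : ∃ z, Y - Z = 4*z := ⟨(Y-Z)/4, by omega⟩
          have eY : Y = 2*y+2*z := by omega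
          have eZ : Z = 2*y-2*z := by omega
          subst hx eY eZ
          refine ⟨(x, y, z), ?_, rfl⟩
          change (n:ℤ) = x*(x+1)/2+y^2+z^2
          obtain ⟨t, h3, h4⟩ := tri x
          rw [h3]
          linarith
        · rintro ⟨⟨x, y, z⟩, hp, he⟩
          change (n:ℤ) = x*(x+1)/2+y^2+z^2 at hp
          obtain ⟨t, h3, h4⟩ := tri x
          rw [h3] at hp
          simp only [ff, Prod.mk.injEq] at he
          obtain ⟨rfl, rfl, rfl⟩ := he
          refine ⟨?_, by simp only; omega⟩
          simp only
          linear_combination 4*h4 - 8*hp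
    _ = _ := Set.ncard_image_of_injective _ ff_inj
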